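/- arXiv:1901.07758 — 3 statements merged into one kernel-verified Lean document; each statement's English description precedes it below -/
import Mathlib

section
/- (Kolmogorov Superposition Theorem.) For every integer d ≥ 1 there exist d constants λ_1, …, λ_d > 0 with Σ_{j=1}^d λ_j ≤ 1, and 2d+1 strictly increasing continuous functions φ_1, …, φ_{2d+1} mapping [0,1] into itself, such that every continuous function f of d variables on [0,1]^d can be represented in the form f(x_1, …, x_d) = Σ_{i=1}^{2d+1} g( Σ_{j=1}^d λ_j φ_i(x_j) ) for some continuous function g : [0,1] → ℝ depending on f. -/
open Set in
lemma kst_lam (d : ℕ) (hd : 1 ≤ d) : ∃ lam : Fin d → ℝ, (∀ j, 0 < lam j) ∧ (∑ j, lam j ≤ 1) ∧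
    ∀ q : Fin d → ℚ, ∑ j, lam j * (q j : ℝ) = 0 → ∀ j, q j = 0 := by
  have hdpos : (0 : ℝ) < d := by exact_mod_cast hd
  have hdense := (Algebraic.countable ℚ ℝ).dense_compl ℝ
  obtain ⟨t, ht, htr⟩ := hdense.exists_between (show (0 : ℝ) < 1 / d by positivity)
  have htr' := htr
  have htle : t ≤ 1 := by
    have : (1 : ℝ) / d ≤ 1 := by
      rw [div_le_one hdpos]; exact_mod_cast hd
    linarith [htr.2]
  refine ⟨fun j => t ^ ((j : ℕ) + 1), fun j => pow_pos htr.1 _, ?_, ?_⟩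
  · calc ∑ j : Fin d, t ^ ((j : ℕ) + 1) ≤ ∑ j : Fin d, 1 / (d : ℝ) := by
          apply Finset.sum_le_sum
          intro j _
          calc t ^ ((j : ℕ) + 1) ≤ t ^ 1 := pow_le_pow_of_le_one htr.1.le htle (by omega)
            _ ≤ _ := by rw [pow_one]; exact htr.2.le
      _ = 1 := by simp; field_simp
  · intro q hq j
    by_contra hne
    apply ht
    refine ⟨∑ j : Fin d, Polynomial.C (q j) * Polynomial.X ^ ((j : ℕ) + 1), ?_, ?_⟩
    · intro h0
      have := congrArg (fun p => Polynomial.coeff p ((j : ℕ) + 1)) h0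
      simp only [Polynomial.finsetSum_coeff, Polynomial.coeff_C_mul_X_pow, Polynomial.coeff_zero,
        add_left_inj] at this
      rw [Finset.sum_eq_single j] at this
      · simp at this; exact hne this
      · intro b _ hb
        rw [if_neg]
        intro h; exact hb (Fin.ext h.symm)
      · simp
    · rw [map_sum, ← hq]
      apply Finset.sum_congr rfl
      intro j _
      rw [map_mul, Polynomial.aeval_C, map_pow, Polynomial.aeval_X, mul_comm, eq_ratCast]

/-- the staircase -/
noncomputable def kstStair (n i N : ℕ) (v : ℕ → ℝ) (s : ℝ) : ℝ :=
  v 0 + ∑ k ∈ Finset.range N, (v (k + 1) - v k) * max 0 (min 1 (s - n * k - i))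

lemma kstStair_cont (n i N : ℕ) (v : ℕ → ℝ) : Continuous (kstStair n i N v) := by
  unfold kstStair; fun_prop

lemma kstStair_mono (n i N : ℕ) (v : ℕ → ℝ) (hv : Monotone v) : Monotone (kstStair n i N v) := by
  intro a b hab
  unfold kstStair
  gcongr with k hk
  exact sub_nonneg.2 (hv (Nat.le_succ k))

/-- value on the `k`-th plateau -/
lemma kstStair_val (n i N : ℕ) (v : ℕ → ℝ) (k : ℕ) (hk : k ≤ N) (s : ℝ)
    (h1 : (n : ℝ) * k + i + 1 ≤ s + n) (h2 : s ≤ n * k + i) : kstStair n i N v s = v k := by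
  unfold kstStair
  have : ∀ m ∈ Finset.range N, (v (m + 1) - v m) * max 0 (min 1 (s - n * m - i)) =
      if m < k then v (m + 1) - v m else 0 := by
    intro m _
    split_ifs with h
    · have h' : (m : ℝ) + 1 ≤ k := by exact_mod_cast h
      have : (n : ℝ) * (m + 1) ≤ n * k := by gcongr
      have h3 : 1 ≤ s - n * m - i := by linarith
      rw [min_eq_left h3]; simp
    · have h' : (k : ℝ) ≤ m := by exact_mod_cast not_lt.1 h
      have : (n : ℝ) * k ≤ n * m := by gcongr
      rw [max_eq_left]; · simp
      exact (min_le_right _ _).trans (by linarith)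
  rw [Finset.sum_congr rfl this, ← Finset.sum_filter]
  have : (Finset.range N).filter (fun m => m < k) = Finset.range k := by
    ext m; simp; omega
  rw [this, Finset.sum_range_sub]; ring

/-- plateau index -/
lemma kst_plateau (n i N : ℕ) (hi : i < n) (s : ℝ) (h0 : 0 ≤ s) (hs : s ≤ n * N)
    (hgood : ⌊s⌋₊ % n ≠ i) : ∃ k ≤ N, (n : ℝ) * k + i + 1 ≤ s + n ∧ s ≤ n * k + i := by
  have hm1 := Nat.floor_le h0
  have hm2 := Nat.lt_floor_add_one s
  have hmN : ⌊s⌋₊ ≤ n * N := by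
    have : (⌊s⌋₊ : ℝ) ≤ ((n * N : ℕ) : ℝ) := by push_cast; linarith
    exact_mod_cast this
  set m := ⌊s⌋₊ with hm
  have hdm := Nat.div_add_mod m n
  have hr : m % n < n := Nat.mod_lt _ (by omega)
  set q := m / n
  set r := m % n
  rcases lt_or_gt_of_ne hgood with h | h
  · refine ⟨q, ?_, ?_, ?_⟩
    · by_contra hc
      have : n * (N + 1) ≤ n * q := Nat.mul_le_mul_left _ (by omega)
      rw [Nat.mul_add] at this; omega
    · have : n * q + i + 1 ≤ m + n := by omega
      have : (n : ℝ) * q + i + 1 ≤ m + n := by exact_mod_cast this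
      linarith
    · have : m + 1 ≤ n * q + i := by omega
      have : (m : ℝ) + 1 ≤ n * q + i := by exact_mod_cast this
      linarith
  · refine ⟨q + 1, ?_, ?_, ?_⟩
    · by_contra hc
      have : n * N ≤ n * q := Nat.mul_le_mul_left _ (by omega)
      omega
    · have : n * (q + 1) + i + 1 ≤ m + n := by rw [Nat.mul_add]; omega
      have : (n : ℝ) * ((q + 1 : ℕ) : ℝ) + i + 1 ≤ m + n := by exact_mod_cast this
      linarith
    · have : m + 1 ≤ n * (q + 1) + i := by rw [Nat.mul_add]; omega
      have : (m : ℝ) + 1 ≤ n * ((q + 1 : ℕ) : ℝ) + i := by exact_mod_cast this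
      linarith

open BoundedContinuousFunction in
lemma kst_interp {P : Type*} [Finite P] (y : P → ℝ) (hy : Function.Injective y) (w : P → ℝ)
    (c : ℝ) (hc : 0 ≤ c) (hw : ∀ p, |w p| ≤ c) :
    ∃ h : ℝ →ᵇ ℝ, (∀ p, h (y p) = w p) ∧ ‖h‖ ≤ c := by
  let _ : TopologicalSpace P := ⊥
  have : DiscreteTopology P := ⟨rfl⟩
  have he : Topology.IsClosedEmbedding y := continuous_of_discreteTopology.isClosedEmbedding hy
  obtain ⟨g, hg, hgy⟩ := exists_extension_norm_eq_of_isClosedEmbedding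
    (BoundedContinuousFunction.ofNormedAddCommGroup w continuous_of_discreteTopology c hw) he
  refine ⟨g, fun p => congrFun hgy p, ?_⟩
  rw [hg]
  exact BoundedContinuousFunction.norm_ofNormedAddCommGroup_le _ hc hw

/-- the rational plateau values -/
lemma kst_vals (n N : ℕ) (ε : ℝ) (hε : 0 < ε) (u : Fin n → ℕ → ℝ) (hu : ∀ i, Monotone (u i))
    (hu0 : ∀ i k, u i k ∈ Set.Icc (0 : ℝ) 1) :
    ∃ q : Fin n → ℕ → ℚ, (∀ i, ∀ k ≤ N, ∀ i', ∀ k' ≤ N, q i k = q i' k' → i = i' ∧ k = k') ∧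
      (∀ i, MonotoneOn (q i) (Set.Iic N)) ∧ (∀ i, ∀ k ≤ N, (q i k : ℝ) ∈ Set.Icc (0 : ℝ) 1) ∧
      ∀ i, ∀ k ≤ N, |(q i k : ℝ) - u i k| ≤ ε := by
  obtain ⟨M, hM⟩ := exists_nat_gt (2 / ε)
  set T : ℕ := n * (N + 1) + 1 with hT
  have hTpos : (0 : ℚ) < T := by rw [hT]; positivity
  have hidx : ∀ i : Fin n, ∀ k ≤ N, n * k + i < T := by
    intro i k hk
    have : n * k ≤ n * N := Nat.mul_le_mul_left _ hk
    have := i.2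
    rw [hT, Nat.mul_add]; omega
  have hfr : ∀ i : Fin n, ∀ k ≤ N, ((n * k + i : ℕ) : ℚ) / T < 1 := by
    intro i k hk
    rw [div_lt_one hTpos]; exact_mod_cast hidx i k hk
  have hfr0 : ∀ i : Fin n, ∀ k : ℕ, 0 ≤ ((n * k + i : ℕ) : ℚ) / T := by
    intro i k; positivity
  have hM1 : (0 : ℚ) < M + 1 := by positivity
  have hM1r : (0 : ℝ) < M + 1 := by positivity
  have hbd : ∀ i : Fin n, ∀ k ≤ N, ((⌊M * u i k⌋₊ : ℕ) : ℝ) ≤ M * u i k := fun i k hk =>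
    Nat.floor_le (mul_nonneg (by positivity) (hu0 i k).1)
  refine ⟨fun i k => ((⌊M * u i k⌋₊ : ℕ) + ((n * k + i : ℕ) : ℚ) / T) / (M + 1), ?_, ?_, ?_, ?_⟩
  · intro i k hk i' k' hk' h
    have h := (div_left_inj' hM1.ne').1 h
    have e1 := hfr i k hk
    have e2 := hfr0 i k
    have e3 := hfr i' k' hk'
    have e4 := hfr0 i' k'
    have hfl : ⌊M * u i k⌋₊ = ⌊M * u i' k'⌋₊ := by
      have a1 : ((⌊M * u i k⌋₊ : ℕ) : ℚ) < (⌊M * u i' k'⌋₊ : ℕ) + 1 := by linarith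
      have a2 : ((⌊M * u i' k'⌋₊ : ℕ) : ℚ) < (⌊M * u i k⌋₊ : ℕ) + 1 := by linarith
      have a1 : ⌊M * u i k⌋₊ < ⌊M * u i' k'⌋₊ + 1 := by exact_mod_cast a1
      have a2 : ⌊M * u i' k'⌋₊ < ⌊M * u i k⌋₊ + 1 := by exact_mod_cast a2
      omega
    rw [hfl, add_right_inj, div_left_inj' hTpos.ne'] at h
    have h : n * k + i = n * k' + i' := by exact_mod_cast h
    have hm := congrArg (· % n) h
    simp only [Nat.mul_add_mod, Nat.mod_eq_of_lt i.2, Nat.mod_eq_of_lt i'.2] at hm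
    refine ⟨Fin.ext hm, ?_⟩
    rw [hm, add_left_inj] at h
    exact Nat.eq_of_mul_eq_mul_left (by have := i.2; omega) h
  · intro i k _ k' _ hkk
    have : ⌊M * u i k⌋₊ ≤ ⌊M * u i k'⌋₊ :=
      Nat.floor_mono (mul_le_mul_of_nonneg_left (hu i hkk) (by positivity))
    simp only
    gcongr
  · intro i k hk
    have e1 : ((((n * k + i : ℕ) : ℚ) / T : ℚ) : ℝ) < 1 := by exact_mod_cast hfr i k hk
    have e2 : (0 : ℝ) ≤ ((((n * k + i : ℕ) : ℚ) / T : ℚ) : ℝ) := by exact_mod_cast hfr0 i k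
    have e3 := hbd i k hk
    have e4 : M * u i k ≤ M := mul_le_of_le_one_right (by positivity) (hu0 i k).2
    rw [Rat.cast_div, Rat.cast_add, Rat.cast_add, Rat.cast_natCast, Rat.cast_natCast, Rat.cast_one]
    constructor
    · positivity
    · rw [div_le_one hM1r]; linarith
  · intro i k hk
    have e1 : ((((n * k + i : ℕ) : ℚ) / T : ℚ) : ℝ) < 1 := by exact_mod_cast hfr i k hk
    have e2 : (0 : ℝ) ≤ ((((n * k + i : ℕ) : ℚ) / T : ℚ) : ℝ) := by exact_mod_cast hfr0 i k
    have e3 := hbd i k hk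
    have e4 := Nat.lt_floor_add_one (M * u i k)
    have e5 : 2 ≤ ε * (M + 1) := by
      rw [div_lt_iff₀ hε] at hM; nlinarith
    rw [Rat.cast_div, Rat.cast_add, Rat.cast_add, Rat.cast_natCast, Rat.cast_natCast, Rat.cast_one]
    have e6 := hu0 i k
    have := e6.1
    have := e6.2
    rw [abs_le]
    constructor
    · rw [neg_le_sub_iff_le_add, ← sub_le_iff_le_add, le_div_iff₀ hM1r]
      nlinarith
    · rw [sub_le_iff_le_add, div_le_iff₀ hM1r]
      nlinarith

open BoundedContinuousFunction

/-- the inner sums as continuous functions on the cube -/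
noncomputable def kstA {d : ℕ} (lam : Fin d → ℝ) (φ : C(unitInterval, ℝ)) :
    C(Fin d → unitInterval, ℝ) :=
  ∑ j, lam j • φ.comp ⟨fun x => x j, continuous_apply j⟩

lemma kstA_apply {d : ℕ} (lam : Fin d → ℝ) (φ : C(unitInterval, ℝ)) (x : Fin d → unitInterval) :
    kstA lam φ x = ∑ j, lam j * φ (x j) := by
  simp [kstA, ContinuousMap.sum_apply]

lemma kstA_cont {d : ℕ} (lam : Fin d → ℝ) : Continuous (kstA lam) := by
  unfold kstA
  refine continuous_finsetSum _ fun j _ => ?_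
  exact (ContinuousMap.continuous_precomp (Z := ℝ)
    (⟨fun x : Fin d → unitInterval => x j, continuous_apply j⟩ : C(_, _))).const_smul (lam j)

/-- the superposition -/
noncomputable def kstT {d n : ℕ} (lam : Fin d → ℝ) (Φ : Fin n → C(unitInterval, ℝ)) (h : ℝ →ᵇ ℝ) :
    C(Fin d → unitInterval, ℝ) :=
  ∑ i, h.toContinuousMap.comp (kstA lam (Φ i))

lemma kstT_apply {d n : ℕ} (lam : Fin d → ℝ) (Φ : Fin n → C(unitInterval, ℝ)) (h : ℝ →ᵇ ℝ)
    (x : Fin d → unitInterval) : kstT lam Φ h x = ∑ i, h (∑ j, lam j * Φ i (x j)) := by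
  simp [kstT, ContinuousMap.sum_apply, kstA_apply]

lemma kstT_cont {d n : ℕ} (lam : Fin d → ℝ) (h : ℝ →ᵇ ℝ) :
    Continuous (fun Φ : Fin n → C(unitInterval, ℝ) => kstT lam Φ h) := by
  unfold kstT
  refine continuous_finsetSum _ fun i _ => ?_
  exact (ContinuousMap.continuous_postcomp _).comp ((kstA_cont lam).comp (continuous_apply i))

/-- tuples of monotone functions into the unit interval -/
def kstX (n : ℕ) : Set (Fin n → C(unitInterval, ℝ)) :=
  {Φ | ∀ i, Monotone (Φ i) ∧ ∀ x, Φ i x ∈ Set.Icc (0 : ℝ) 1}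

lemma kstX_closed (n : ℕ) : IsClosed (kstX n) := by
  have hev : ∀ i x, Continuous (fun Φ : Fin n → C(unitInterval, ℝ) => Φ i x) := fun i x =>
    (continuous_eval_const (F := C(unitInterval, ℝ)) x).comp (continuous_apply i)
  have : kstX n = ⋂ i, ({Φ | ∀ x y, x ≤ y → Φ i x ≤ Φ i y} ∩ {Φ | ∀ x, Φ i x ∈ Set.Icc (0 : ℝ) 1}) := by
    ext Φ; simp [kstX, Monotone]
  rw [this]
  refine isClosed_iInter fun i => IsClosed.inter ?_ ?_
  · simp only [Set.ofPred_forall]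
    exact isClosed_iInter fun x => isClosed_iInter fun y => isClosed_iInter fun _ =>
      isClosed_le (hev i x) (hev i y)
  · simp only [Set.ofPred_forall]
    exact isClosed_iInter fun x => isClosed_Icc.preimage (hev i x)

lemma kst_approx (d : ℕ) (hd : 1 ≤ d) (lam : Fin d → ℝ)
    (hlam : ∀ q : Fin d → ℚ, ∑ j, lam j * (q j : ℝ) = 0 → ∀ j, q j = 0)
    (n : ℕ) (hn : n = 2 * d + 1) (Φ : Fin n → C(unitInterval, ℝ)) (hΦ : Φ ∈ kstX n)
    (f : C(Fin d → unitInterval, ℝ)) (ε η : ℝ) (hε : 0 < ε) (hη : 0 < η) :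
    ∃ Ψ ∈ kstX n, dist Ψ Φ < ε ∧ ∃ h : ℝ →ᵇ ℝ, ‖h‖ ≤ ‖f‖ ∧
      ‖f - kstT lam Ψ h‖ < 2 * d / (2 * d + 1) * ‖f‖ + η := by
  classical
  have hnR : (n : ℝ) = 2 * d + 1 := by rw [hn]; push_cast; ring
  have hn0 : (0 : ℝ) < n := by rw [hnR]; positivity
  -- uniform continuity
  have hfu : UniformContinuous f := CompactSpace.uniformContinuous_of_continuous f.continuous
  obtain ⟨δ₁, hδ₁, hf⟩ := Metric.uniformContinuous_iff.1 hfu (η / 2) (by positivity)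
  have hΦu : ∀ i, UniformContinuous (Φ i) := fun i =>
    CompactSpace.uniformContinuous_of_continuous (Φ i).continuous
  choose δ₂ hδ₂ hΦδ using fun i => Metric.uniformContinuous_iff.1 (hΦu i) (ε / 4) (by positivity)
  obtain ⟨N, hN0, hN1, hN2⟩ : ∃ N : ℕ, 0 < N ∧ 1 / (N : ℝ) < δ₁ ∧ ∀ i, 1 / (N : ℝ) < δ₂ i := by
    have key : ∀ δ : ℝ, 0 < δ → ∀ᶠ N : ℕ in Filter.atTop, 1 / (N : ℝ) < δ := fun δ h =>
      (tendsto_one_div_atTop_nhds_zero_nat (𝕜 := ℝ)).eventually_lt_const h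
    exact ((Filter.eventually_gt_atTop 0).and ((key _ hδ₁).and
      (Filter.eventually_all.2 fun i => key _ (hδ₂ i)))).exists
  have hNR : (0 : ℝ) < N := by exact_mod_cast hN0
  -- sample points
  let p : ℕ → unitInterval := fun k => Set.projIcc 0 1 zero_le_one ((k : ℝ) / N)
  have hpm : Monotone p := fun a b hab => Set.monotone_projIcc _ (by gcongr)
  have hp : ∀ k ≤ N, ((p k : unitInterval) : ℝ) = k / N := by
    intro k hk
    have : (k : ℝ) / N ∈ Set.Icc (0 : ℝ) 1 :=
      ⟨by positivity, by rw [div_le_one hNR]; exact_mod_cast hk⟩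
    simp only [p]
    rw [Set.projIcc_of_mem zero_le_one this]
  obtain ⟨q, hqinj, hqm, hq01, hqu⟩ := kst_vals n N (ε / 4) (by positivity) (fun i k => Φ i (p k))
    (fun i a b hab => (hΦ i).1 (hpm hab)) (fun i k => (hΦ i).2 _)
  let v : Fin n → ℕ → ℝ := fun i k => (q i (min k N) : ℝ)
  have hvm : ∀ i, Monotone (v i) := by
    intro i a b hab
    simp only [v]
    exact_mod_cast hqm i (Set.mem_Iic.2 (min_le_right a N)) (Set.mem_Iic.2 (min_le_right b N))
      (min_le_min_right N hab)
  have hvq : ∀ i, ∀ k ≤ N, v i k = q i k := by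
    intro i k hk; simp only [v]; rw [min_eq_left hk]
  let Ψ : Fin n → C(unitInterval, ℝ) := fun i =>
    ⟨fun x => kstStair n i N (v i) (n * N * (x : ℝ)),
      (kstStair_cont n i N (v i)).comp (by fun_prop)⟩
  have hΨ : ∀ i x, Ψ i x = kstStair n i N (v i) (n * N * (x : ℝ)) := fun i x => rfl
  have hΨm : ∀ i, Monotone (Ψ i) := by
    intro i a b hab
    rw [hΨ, hΨ]
    apply kstStair_mono _ _ _ _ (hvm i)
    have : (a : ℝ) ≤ b := hab
    gcongr
  have hΨp : ∀ i, ∀ k ≤ N, Ψ i (p k) = q i k := by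
    intro i k hk
    rw [hΨ, hp k hk, ← hvq i k hk]
    have e : (n : ℝ) * N * (k / N) = n * k := by field_simp
    have hi : ((i : ℕ) : ℝ) + 1 ≤ n := by exact_mod_cast i.2
    apply kstStair_val _ _ _ _ _ hk
    · rw [e]; linarith
    · rw [e]; have : (0 : ℝ) ≤ (i : ℕ) := by positivity
      linarith
  -- every point lies between two consecutive sample points
  have hbtw : ∀ x : unitInterval, ∃ k, k + 1 ≤ N ∧ p k ≤ x ∧ x ≤ p (k + 1) := by
    intro x
    have hx0 := x.2.1
    have hx1 := x.2.2
    by_cases hx : (x : ℝ) = 1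
    · refine ⟨N - 1, by omega, ?_, ?_⟩
      · rw [← Subtype.coe_le_coe, hx]; exact (p _).2.2
      · rw [← Subtype.coe_le_coe, hp _ (by omega), hx]
        rw [Nat.sub_add_cancel (by omega), div_self hNR.ne']
    · have hx1 : (x : ℝ) < 1 := lt_of_le_of_ne hx1 hx
      have h0 : 0 ≤ N * (x : ℝ) := by positivity
      have hk : ⌊N * (x : ℝ)⌋₊ < N := by
        rw [Nat.floor_lt h0]; nlinarith
      refine ⟨⌊N * (x : ℝ)⌋₊, hk, ?_, ?_⟩
      · rw [← Subtype.coe_le_coe, hp _ hk.le, div_le_iff₀ hNR, mul_comm (x : ℝ)]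
        exact Nat.floor_le h0
      · rw [← Subtype.coe_le_coe, hp _ hk, le_div_iff₀ hNR, mul_comm (x : ℝ)]
        push_cast
        exact (Nat.lt_floor_add_one _).le
  have hΨX : Ψ ∈ kstX n := by
    refine fun i => ⟨hΨm i, fun x => ?_⟩
    obtain ⟨k, hk, h1, h2⟩ := hbtw x
    have a1 := hΨm i h1
    have a2 := hΨm i h2
    rw [hΨp i k (by omega)] at a1
    rw [hΨp i (k + 1) hk] at a2
    exact ⟨(hq01 i k (by omega)).1.trans a1, a2.trans (hq01 i (k + 1) hk).2⟩
  have hdist : dist Ψ Φ < ε := by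
    rw [dist_pi_lt_iff hε]
    intro i
    refine lt_of_le_of_lt ((ContinuousMap.dist_le (by positivity : 0 ≤ ε / 2)).2 fun x => ?_)
      (half_lt_self hε)
    obtain ⟨k, hk, h1, h2⟩ := hbtw x
    have a1 := hΨm i h1
    have a2 := hΨm i h2
    rw [hΨp i k (by omega)] at a1
    rw [hΨp i (k + 1) hk] at a2
    have b1 := (hΦ i).1 h1
    have b2 := (hΦ i).1 h2
    have c1 := hqu i k (by omega)
    have c2 := hqu i (k + 1) hk
    have hd' : dist (p k) (p (k + 1)) < δ₂ i := by
      refine lt_of_le_of_lt ?_ (hN2 i)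
      rw [Subtype.dist_eq, hp k (by omega), hp (k + 1) hk, Real.dist_eq, abs_sub_comm]
      have : (((k + 1 : ℕ) : ℝ) / N - k / N) = 1 / N := by push_cast; ring
      rw [this, abs_of_pos (by positivity)]
    have c3 := hΦδ i hd'
    rw [Real.dist_eq] at c3 ⊢
    rw [abs_le] at c1 c2 ⊢
    rw [abs_lt] at c3
    constructor <;> linarith [c1.1, c1.2, c2.1, c2.2, c3.1, c3.2]
  -- the outer function
  let y : Fin n × (Fin d → Fin (N + 1)) → ℝ := fun P => ∑ j, lam j * (q P.1 (P.2 j) : ℝ)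
  have hkN : ∀ k : Fin (N + 1), (k : ℕ) ≤ N := fun k => Nat.lt_succ_iff.1 k.2
  have hy : Function.Injective y := by
    rintro ⟨i, k⟩ ⟨i', k'⟩ h
    have h0 : ∑ j, lam j * ((q i (k j) - q i' (k' j) : ℚ) : ℝ) = 0 := by
      have : ∑ j, lam j * (q i (k j) : ℝ) = ∑ j, lam j * (q i' (k' j) : ℝ) := h
      simp only [Rat.cast_sub, mul_sub, Finset.sum_sub_distrib]
      linarith
    have h1 := hlam _ h0
    have h2 : ∀ j, i = i' ∧ (k j : ℕ) = k' j := fun j =>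
      hqinj i _ (hkN _) i' _ (hkN _) (sub_eq_zero.1 (h1 j))
    rw [Prod.mk.injEq]
    exact ⟨(h2 ⟨0, hd⟩).1, funext fun j => Fin.ext (h2 j).2⟩
  obtain ⟨h, hhy, hhn⟩ := kst_interp y hy (fun P => f (fun j => p (P.2 j)) / n) (‖f‖ / n)
    (by positivity) (fun P => by
      rw [abs_div, abs_of_pos hn0]
      gcongr
      exact f.norm_coe_le_norm _)
  refine ⟨Ψ, hΨX, hdist, h, hhn.trans (div_le_self (norm_nonneg _) ?_), ?_⟩
  · rw [hnR]; linarith [show (0 : ℝ) ≤ d by positivity]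
  have hmain : ‖f - kstT lam Ψ h‖ ≤ 2 * d / (2 * d + 1) * ‖f‖ + η / 2 := by
    rw [ContinuousMap.norm_le _ (by positivity)]
    intro x
    rw [ContinuousMap.sub_apply, kstT_apply]
    let B : Finset ℕ := Finset.univ.image fun j : Fin d => ⌊(n : ℝ) * N * (x j : ℝ)⌋₊ % n
    have hB : B.card ≤ d := by
      simpa using (Finset.card_image_le (s := Finset.univ)
        (f := fun j : Fin d => ⌊(n : ℝ) * N * (x j : ℝ)⌋₊ % n))
    have hterm : ∀ i : Fin n, |f x / n - h (∑ j, lam j * Ψ i (x j))| ≤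
        η / 2 / n + if (i : ℕ) ∈ B then 2 * ‖f‖ / n else 0 := by
      intro i
      split_ifs with hi
      · have e1 : |f x / n| ≤ ‖f‖ / n := by
          rw [abs_div, abs_of_pos hn0]
          gcongr
          exact f.norm_coe_le_norm _
        have e2 : |h (∑ j, lam j * Ψ i (x j))| ≤ ‖f‖ / n := (h.norm_coe_le_norm _).trans hhn
        have e3 : 0 ≤ η / 2 / n := by positivity
        calc _ ≤ |f x / n| + |h (∑ j, lam j * Ψ i (x j))| := abs_sub _ _
          _ ≤ ‖f‖ / n + ‖f‖ / n := add_le_add e1 e2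
          _ = 2 * ‖f‖ / n := by ring
          _ ≤ _ := by linarith
      · have hgood : ∀ j, ⌊(n : ℝ) * N * (x j : ℝ)⌋₊ % n ≠ i := by
          intro j hj
          exact hi (Finset.mem_image.2 ⟨j, Finset.mem_univ _, hj⟩)
        have hpl := fun j => kst_plateau n i N i.2 (n * N * (x j : ℝ))
          (mul_nonneg (by positivity) (x j).2.1)
          (mul_le_of_le_one_right (by positivity) (x j).2.2) (hgood j)
        choose k hk hk1 hk2 using hpl
        have hval : ∀ j, Ψ i (x j) = q i (k j) := by
          intro j
          rw [hΨ, kstStair_val n i N (v i) (k j) (hk j) _ (hk1 j) (hk2 j), hvq i _ (hk j)]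
        have hh := hhy (i, fun j => ⟨k j, Nat.lt_succ_of_le (hk j)⟩)
        have : ∑ j, lam j * Ψ i (x j) = y (i, fun j => ⟨k j, Nat.lt_succ_of_le (hk j)⟩) := by
          simp only [y, hval]
        rw [this, hh, add_zero, ← sub_div, abs_div, abs_of_pos hn0]
        gcongr
        have hdx : dist x (fun j => p (k j)) < δ₁ := by
          rw [dist_pi_lt_iff hδ₁]
          intro j
          refine lt_of_le_of_lt ?_ hN1
          rw [Subtype.dist_eq, hp _ (hk j), Real.dist_eq]
          have e : (x j : ℝ) - k j / N = (n * N * (x j : ℝ) - n * k j) / (n * N) := by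
            field_simp
          have hi : ((i : ℕ) : ℝ) + 1 ≤ n := by exact_mod_cast i.2
          have hi0 : (0 : ℝ) ≤ (i : ℕ) := by positivity
          have e2 : (1 : ℝ) / N = n / (n * N) := by field_simp
          rw [e, e2, abs_div, abs_of_pos (show (0 : ℝ) < n * N by positivity)]
          gcongr
          rw [abs_le]
          constructor <;> linarith [hk1 j, hk2 j]
        exact (hf hdx).le
    have hsum : f x - ∑ i, h (∑ j, lam j * Ψ i (x j)) =
        ∑ i : Fin n, (f x / n - h (∑ j, lam j * Ψ i (x j))) := by
      rw [Finset.sum_sub_distrib]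
      simp only [Finset.sum_const, Finset.card_univ, Fintype.card_fin, nsmul_eq_mul]
      rw [mul_div_cancel₀ _ hn0.ne']
    rw [hsum]
    have hcount : (((Finset.univ : Finset (Fin n)).filter (fun i : Fin n => (i : ℕ) ∈ B)).card : ℝ) ≤ d := by
      have : ((Finset.univ : Finset (Fin n)).filter (fun i : Fin n => (i : ℕ) ∈ B)).card ≤ B.card := by
        apply Finset.card_le_card_of_injOn (fun i : Fin n => (i : ℕ))
        · intro i hi
          simpa using hi
        · intro a _ b _ hab
          exact Fin.ext hab
      exact_mod_cast this.trans hB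
    calc ‖∑ i : Fin n, (f x / n - h (∑ j, lam j * Ψ i (x j)))‖
        ≤ ∑ i : Fin n, |f x / n - h (∑ j, lam j * Ψ i (x j))| := Finset.abs_sum_le_sum_abs _ _
      _ ≤ ∑ i : Fin n, (η / 2 / n + if (i : ℕ) ∈ B then 2 * ‖f‖ / n else 0) :=
          Finset.sum_le_sum fun i _ => hterm i
      _ = η / 2 + ((Finset.univ : Finset (Fin n)).filter (fun i : Fin n => (i : ℕ) ∈ B)).card *
            (2 * ‖f‖ / n) := by
          rw [Finset.sum_add_distrib, ← Finset.sum_filter]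
          simp only [Finset.sum_const, Finset.card_univ, Fintype.card_fin, nsmul_eq_mul]
          rw [mul_div_cancel₀ _ hn0.ne']
      _ ≤ η / 2 + d * (2 * ‖f‖ / n) := by gcongr
      _ = _ := by rw [hnR]; ring
  linarith

lemma kst_baire (d : ℕ) (hd : 1 ≤ d) (lam : Fin d → ℝ)
    (hlam : ∀ q : Fin d → ℚ, ∑ j, lam j * (q j : ℝ) = 0 → ∀ j, q j = 0) :
    ∃ Φ ∈ kstX (2 * d + 1), (∀ i, StrictMono (Φ i)) ∧
      ∀ k m : ℕ, ∃ h : ℝ →ᵇ ℝ, ‖h‖ ≤ ‖TopologicalSpace.denseSeq C(Fin d → unitInterval, ℝ) k‖ ∧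
        ‖TopologicalSpace.denseSeq C(Fin d → unitInterval, ℝ) k - kstT lam Φ h‖ <
          2 * d / (2 * d + 1) * ‖TopologicalSpace.denseSeq C(Fin d → unitInterval, ℝ) k‖ +
            1 / ((m : ℝ) + 1) := by
  have : CompleteSpace (kstX (2 * d + 1)) := (kstX_closed _).completeSpace_coe
  have hU : ∀ k m : ℕ, ∀ᶠ Φ in residual (kstX (2 * d + 1)), ∃ h : ℝ →ᵇ ℝ,
      ‖h‖ ≤ ‖TopologicalSpace.denseSeq C(Fin d → unitInterval, ℝ) k‖ ∧
        ‖TopologicalSpace.denseSeq C(Fin d → unitInterval, ℝ) k - kstT lam Φ.1 h‖ <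
          2 * d / (2 * d + 1) * ‖TopologicalSpace.denseSeq C(Fin d → unitInterval, ℝ) k‖ +
            1 / ((m : ℝ) + 1) := by
    intro k m
    apply residual_of_dense_open
    · simp only [Set.ofPred_exists, Set.ofPred_and]
      refine isOpen_iUnion fun h => isOpen_const.inter (isOpen_lt ?_ continuous_const)
      exact (continuous_const.sub ((kstT_cont lam h).comp continuous_subtype_val)).norm
    · rw [Metric.dense_iff]
      intro Φ ε hε
      obtain ⟨Ψ, hΨ, hdist, hh⟩ := kst_approx d hd lam hlam _ rfl Φ.1 Φ.2
        (TopologicalSpace.denseSeq C(Fin d → unitInterval, ℝ) k) ε (1 / ((m : ℝ) + 1)) hε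
        (by positivity)
      exact ⟨⟨Ψ, hΨ⟩, hdist, hh⟩
  have hV : ∀ (i : Fin (2 * d + 1)) (a b : ℕ), ∀ᶠ Φ in residual (kstX (2 * d + 1)),
      TopologicalSpace.denseSeq unitInterval a < TopologicalSpace.denseSeq unitInterval b →
      Φ.1 i (TopologicalSpace.denseSeq unitInterval a) <
        Φ.1 i (TopologicalSpace.denseSeq unitInterval b) := by
    intro i a b
    by_cases hab : TopologicalSpace.denseSeq unitInterval a < TopologicalSpace.denseSeq unitInterval b
    swap
    · exact Filter.Eventually.of_forall fun _ h => absurd h hab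
    simp only [hab, true_imp_iff]
    generalize TopologicalSpace.denseSeq unitInterval a = a at hab
    generalize TopologicalSpace.denseSeq unitInterval b = b at hab
    have hev : ∀ x, Continuous (fun Φ : kstX (2 * d + 1) => Φ.1 i x) := fun x =>
      (continuous_eval_const (F := C(unitInterval, ℝ)) x).comp
        ((continuous_apply i).comp continuous_subtype_val)
    apply residual_of_dense_open
    · exact isOpen_lt (hev a) (hev b)
    · rw [Metric.dense_iff]
      intro Φ ε hε
      obtain ⟨t, ht0, ht⟩ := exists_between (lt_min hε one_pos)
      have ht1 : t < 1 := ht.trans_le (min_le_right _ _)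
      have ht2 : t < ε := ht.trans_le (min_le_left _ _)
      let Ψ : Fin (2 * d + 1) → C(unitInterval, ℝ) := fun i =>
        ⟨fun x => (1 - t) * Φ.1 i x + t * (x : ℝ), by fun_prop⟩
      have hΨ : ∀ i x, Ψ i x = (1 - t) * Φ.1 i x + t * (x : ℝ) := fun _ _ => rfl
      refine ⟨⟨Ψ, ?_⟩, ?_, ?_⟩
      · intro i
        constructor
        · intro x y hxy
          rw [hΨ, hΨ]
          have h1 := (Φ.2 i).1 hxy
          have h2 : (x : ℝ) ≤ y := hxy
          have : 0 ≤ 1 - t := by linarith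
          gcongr
        · intro x
          rw [hΨ]
          have h1 := (Φ.2 i).2 x
          exact (convex_Icc (0 : ℝ) 1) h1 x.2 (by linarith) ht0.le (by ring)
      · rw [Metric.mem_ball, Subtype.dist_eq]
        change dist Ψ Φ.1 < ε
        refine lt_of_le_of_lt ((dist_pi_le_iff ht0.le).2 fun i => ?_) ht2
        refine (ContinuousMap.dist_le ht0.le).2 fun x => ?_
        rw [hΨ, Real.dist_eq]
        have h1 := (Φ.2 i).2 x
        have h2 := x.2
        have : (1 - t) * Φ.1 i x + t * (x : ℝ) - Φ.1 i x = t * (x - Φ.1 i x) := by ring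
        rw [this, abs_mul, abs_of_pos ht0]
        apply mul_le_of_le_one_right ht0.le
        rw [abs_le]
        constructor <;> linarith [h1.1, h1.2, h2.1, h2.2]
      · change Ψ i a < Ψ i b
        rw [hΨ, hΨ]
        have h1 := (Φ.2 i).1 hab.le
        have h2 : (a : ℝ) < b := hab
        have : 0 ≤ 1 - t := by linarith
        nlinarith
  have hall := (Filter.eventually_all.2 fun i => eventually_countable_forall.2 fun a =>
    eventually_countable_forall.2 fun b => hV i a b).and
      (eventually_countable_forall.2 fun k => eventually_countable_forall.2 fun m => hU k m)
  have hne : Nonempty (kstX (2 * d + 1)) :=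
    ⟨⟨fun _ => ContinuousMap.const _ 0, fun i => ⟨fun _ _ _ => le_rfl, fun x => by simp⟩⟩⟩
  obtain ⟨Φ, hΦ1, hΦ2⟩ := (dense_of_mem_residual hall).nonempty
  refine ⟨Φ.1, Φ.2, ?_, hΦ2⟩
  intro i x y hxy
  have hD := TopologicalSpace.denseRange_denseSeq unitInterval
  obtain ⟨_, ⟨a, rfl⟩, ha⟩ := hD.exists_between hxy
  obtain ⟨_, ⟨b, rfl⟩, hb⟩ := hD.exists_between ha.2
  exact ((Φ.2 i).1 ha.1.le).trans_lt ((hΦ1 i a b hb.1).trans_le ((Φ.2 i).1 hb.2.le))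

lemma kst_step (d : ℕ) (lam : Fin d → ℝ) (Φ : Fin (2 * d + 1) → C(unitInterval, ℝ))
    (hΦ : ∀ k m : ℕ, ∃ h : ℝ →ᵇ ℝ,
      ‖h‖ ≤ ‖TopologicalSpace.denseSeq C(Fin d → unitInterval, ℝ) k‖ ∧
        ‖TopologicalSpace.denseSeq C(Fin d → unitInterval, ℝ) k - kstT lam Φ h‖ <
          2 * d / (2 * d + 1) * ‖TopologicalSpace.denseSeq C(Fin d → unitInterval, ℝ) k‖ +
            1 / ((m : ℝ) + 1)) :
    ∃ θ : ℝ, 0 ≤ θ ∧ θ < 1 ∧ ∀ f : C(Fin d → unitInterval, ℝ), ∃ h : ℝ →ᵇ ℝ, ‖h‖ ≤ 2 * ‖f‖ ∧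
      ‖f - kstT lam Φ h‖ ≤ θ * ‖f‖ := by
  set τ : ℝ := 1 / (2 * d + 1) with hτ
  have hτ0 : 0 < τ := by positivity
  have hτ1 : τ ≤ 1 := by
    rw [hτ, div_le_one (by positivity)]; linarith [show (0 : ℝ) ≤ d by positivity]
  have hτ2 : (2 * d / (2 * d + 1) : ℝ) = 1 - τ := by rw [hτ]; field_simp; ring
  refine ⟨1 - τ / 4, by linarith, by linarith, fun f => ?_⟩
  rcases eq_or_ne f 0 with rfl | hf
  · refine ⟨0, by simp, ?_⟩
    have : kstT lam Φ (0 : ℝ →ᵇ ℝ) = 0 := by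
      ext x; rw [kstT_apply]; simp
    rw [this]; simp
  have hfn : 0 < ‖f‖ := norm_pos_iff.2 hf
  obtain ⟨k, hk⟩ := (TopologicalSpace.denseRange_denseSeq C(Fin d → unitInterval, ℝ)).exists_dist_lt
    f (show 0 < τ / 4 * ‖f‖ by positivity)
  obtain ⟨m, hm⟩ := exists_nat_one_div_lt (show 0 < τ / 4 * ‖f‖ by positivity)
  obtain ⟨h, h1, h2⟩ := hΦ k m
  generalize TopologicalSpace.denseSeq C(Fin d → unitInterval, ℝ) k = F at *
  rw [hτ2] at h2
  rw [dist_eq_norm] at hk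
  have hF : ‖F‖ ≤ ‖f‖ + τ / 4 * ‖f‖ := by
    calc ‖F‖ = ‖f - (f - F)‖ := by rw [sub_sub_cancel]
      _ ≤ ‖f‖ + ‖f - F‖ := norm_sub_le _ _
      _ ≤ _ := by gcongr
  refine ⟨h, ?_, ?_⟩
  · nlinarith
  · calc ‖f - kstT lam Φ h‖ = ‖(f - F) + (F - kstT lam Φ h)‖ := by rw [sub_add_sub_cancel]
      _ ≤ ‖f - F‖ + ‖F - kstT lam Φ h‖ := norm_add_le _ _
      _ ≤ τ / 4 * ‖f‖ + ((1 - τ) * ‖F‖ + τ / 4 * ‖f‖) := by linarith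
      _ ≤ τ / 4 * ‖f‖ + ((1 - τ) * (‖f‖ + τ / 4 * ‖f‖) + τ / 4 * ‖f‖) := by
          have : 0 ≤ 1 - τ := by linarith
          gcongr
      _ ≤ _ := by nlinarith [mul_pos (mul_pos hτ0 hτ0) hfn]

lemma kst_surj {d n : ℕ} (lam : Fin d → ℝ) (Φ : Fin n → C(unitInterval, ℝ)) (θ : ℝ) (h0 : 0 ≤ θ)
    (h1 : θ < 1) (hs : ∀ f : C(Fin d → unitInterval, ℝ), ∃ h : ℝ →ᵇ ℝ, ‖h‖ ≤ 2 * ‖f‖ ∧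
      ‖f - kstT lam Φ h‖ ≤ θ * ‖f‖) (f : C(Fin d → unitInterval, ℝ)) :
    ∃ g : ℝ →ᵇ ℝ, ∀ x, f x = ∑ i, g (∑ j, lam j * Φ i (x j)) := by
  choose H hH1 hH2 using hs
  let r : ℕ → C(Fin d → unitInterval, ℝ) := fun k => (fun F => F - kstT lam Φ (H F))^[k] f
  have hr0 : r 0 = f := rfl
  have hrs : ∀ k, r (k + 1) = r k - kstT lam Φ (H (r k)) := fun k =>
    Function.iterate_succ_apply' _ _ _
  have hrn : ∀ k, ‖r k‖ ≤ θ ^ k * ‖f‖ := by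
    intro k
    induction k with
    | zero => simp [hr0]
    | succ k ih =>
      rw [hrs]
      calc _ ≤ θ * ‖r k‖ := hH2 _
        _ ≤ θ * (θ ^ k * ‖f‖) := by gcongr
        _ = _ := by ring
  have hgeo := (summable_geometric_of_lt_one h0 h1)
  have hsum : Summable (fun k => H (r k)) := by
    refine Summable.of_norm_bounded (g := fun k => 2 * (θ ^ k * ‖f‖)) ?_ ?_
    · exact (hgeo.mul_right _).mul_left _
    · intro k
      exact (hH1 _).trans (by gcongr; exact hrn k)
  refine ⟨∑' k, H (r k), fun x => ?_⟩
  have hev : ∀ y, Filter.Tendsto (fun K => ∑ k ∈ Finset.range K, H (r k) y) Filter.atTop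
      (nhds ((∑' k, H (r k)) y)) := by
    intro y
    have h := hsum.hasSum.tendsto_sum_nat
    have h2 := ((continuous_eval_const (F := ℝ →ᵇ ℝ) y).tendsto _).comp h
    refine h2.congr fun K => ?_
    simp
  have hT : Filter.Tendsto (fun K => ∑ i, ∑ k ∈ Finset.range K, H (r k) (∑ j, lam j * Φ i (x j)))
      Filter.atTop (nhds (∑ i, (∑' k, H (r k)) (∑ j, lam j * Φ i (x j)))) :=
    tendsto_finsetSum _ fun i _ => hev _
  have hpart : ∀ K, ∑ i, ∑ k ∈ Finset.range K, H (r k) (∑ j, lam j * Φ i (x j)) = f x - r K x := by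
    intro K
    rw [Finset.sum_comm]
    have : ∀ k ∈ Finset.range K, ∑ i, H (r k) (∑ j, lam j * Φ i (x j)) = r k x - r (k + 1) x := by
      intro k _
      rw [hrs, ContinuousMap.sub_apply, kstT_apply]; ring
    rw [Finset.sum_congr rfl this, Finset.sum_range_sub', hr0]
  have hr : Filter.Tendsto (fun K => r K x) Filter.atTop (nhds 0) := by
    refine squeeze_zero_norm (a := fun K => θ ^ K * ‖f‖)
      (fun K => ((r K).norm_coe_le_norm x).trans (hrn K)) ?_
    simpa using (tendsto_pow_atTop_nhds_zero_of_lt_one h0 h1).mul_const ‖f‖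
  have hT2 : Filter.Tendsto (fun K => f x - r K x) Filter.atTop (nhds (f x)) := by
    simpa using tendsto_const_nhds.sub hr
  simp only [hpart] at hT
  exact tendsto_nhds_unique hT2 hT


/-- **Kolmogorov Superposition Theorem.** For every `d ≥ 1` there exist constants
`λ_1, …, λ_d > 0` with `Σ_j λ_j ≤ 1` and `2d+1` strictly increasing continuous
functions `φ_i : [0,1] → [0,1]` such that every continuous `f : [0,1]^d → ℝ` can
be written `f(x) = Σ_{i=1}^{2d+1} g(Σ_{j=1}^d λ_j φ_i(x_j))` for some
continuous `g : [0,1] → ℝ` depending on `f`. -/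
theorem kolmogorov_superposition (d : ℕ) (hd : 1 ≤ d) :
    ∃ (lam : Fin d → ℝ) (φ : Fin (2 * d + 1) → ℝ → ℝ),
      (∀ j, 0 < lam j) ∧ (∑ j, lam j ≤ 1) ∧
      (∀ i, StrictMonoOn (φ i) (Set.Icc 0 1) ∧ ContinuousOn (φ i) (Set.Icc 0 1) ∧
        Set.MapsTo (φ i) (Set.Icc 0 1) (Set.Icc 0 1)) ∧
      ∀ f : (Fin d → ℝ) → ℝ,
        ContinuousOn f (Set.univ.pi fun _ => Set.Icc 0 1) →
        ∃ g : ℝ → ℝ, ContinuousOn g (Set.Icc 0 1) ∧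
          ∀ x ∈ Set.univ.pi fun _ : Fin d => Set.Icc (0 : ℝ) 1,
            f x = ∑ i, g (∑ j, lam j * φ i (x j)) := by
  obtain ⟨lam, hpos, hsum, hlam⟩ := kst_lam d hd
  obtain ⟨Φ, hΦ, hstrict, hden⟩ := kst_baire d hd lam hlam
  obtain ⟨θ, h0, h1, hs⟩ := kst_step d lam Φ hden
  refine ⟨lam, fun i => Set.IccExtend zero_le_one (Φ i), hpos, hsum, fun i => ⟨?_, ?_, ?_⟩, ?_⟩
  · exact (hstrict i).strictMonoOn_IccExtend zero_le_one
  · exact (Φ i).continuous.Icc_extend'.continuousOn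
  · intro x _
    exact (hΦ i).2 _
  · intro f hf
    let F : C(Fin d → unitInterval, ℝ) := ⟨fun x => f (fun j => (x j : ℝ)), by
      refine hf.comp_continuous (by fun_prop) fun x j _ => (x j).2⟩
    obtain ⟨g, hg⟩ := kst_surj lam Φ θ h0 h1 hs F
    refine ⟨g, g.continuous.continuousOn, fun x hx => ?_⟩
    have hx' : ∀ j, x j ∈ Set.Icc (0 : ℝ) 1 := fun j => hx j (Set.mem_univ j)
    have := hg (fun j => ⟨x j, hx' j⟩)
    calc f x = F (fun j => ⟨x j, hx' j⟩) := rfl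
      _ = _ := this
      _ = _ := by
        refine Finset.sum_congr rfl fun i _ => ?_
        congr 1
        refine Finset.sum_congr rfl fun j _ => ?_
        beta_reduce
        rw [Set.IccExtend_of_mem zero_le_one _ (hx' j)]
end

section
/- There exists an activation function σ : ℝ → ℝ which is real-analytic, strictly increasing, and sigmoidal (σ(t) → 0 as t → −∞ and σ(t) → 1 as t → +∞) with the following property: for every integer d ≥ 1, every continuous function f on [0,1]^d, and every ε > 0, there exist real constants d_i (i = 1, …, 6d+3), c_{ij}, θ_{ij} (i = 1, …, 6d+3, j = 1, …, 3d), γ_i, and vectors w^{ij} ∈ ℝ^d such that |f(x) − Σ_{i=1}^{6d+3} d_i σ( Σ_{j=1}^{3d} c_{ij} σ(w^{ij} · x − θ_{ij}) − γ_i )| < ε for all x = (x_1, …, x_d) ∈ [0,1]^d. -/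
namespace MP
open Set Filter Topology

lemma cells (m : ℕ) (hm : 0 < m) (δ : ℝ) (hδ : 0 < δ) :
    ∃ (K : ℕ) (J : Fin m → Fin K → Set ℝ),
      (∀ q k, IsClosed (J q k)) ∧ (∀ q k, J q k ⊆ Icc 0 1) ∧
      (∀ q k k' t, t ∈ J q k → t ∈ J q k' → k = k') ∧
      (∀ q k s t, s ∈ J q k → t ∈ J q k → |s - t| < δ) ∧
      (∀ t ∈ Icc (0:ℝ) 1, ∀ q q', (∀ k, t ∉ J q k) → (∀ k, t ∉ J q' k) → q = q') := by
  obtain ⟨N, hN⟩ := exists_nat_gt ((m:ℝ) / δ)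
  have hm' : (0:ℝ) < m := by exact_mod_cast hm
  have hN0 : (0:ℝ) < N := lt_trans (by positivity) hN
  have hmN : (m:ℝ) < N * δ := by rwa [div_lt_iff₀ hδ] at hN
  refine ⟨N + m + 1, fun q k => {t | t ∈ Icc (0:ℝ) 1 ∧ (k:ℝ) * m ≤ N * t + (m - q) ∧
    N * t + (m - q) ≤ k * m + (m - 1)}, ?_, ?_, ?_, ?_, ?_⟩
  · intro q k
    have c1 : Continuous fun t : ℝ => (N:ℝ) * t + ((m:ℝ) - (q:ℕ)) := by fun_prop
    exact isClosed_Icc.inter ((isClosed_le continuous_const c1).inter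
      (isClosed_le c1 continuous_const))
  · exact fun q k t ht => ht.1
  · have key : ∀ (q : Fin m) (k k' : Fin (N+m+1)) (t : ℝ), (k' : ℝ) * m ≤ N * t + (m - q) →
        N * t + (m - q) ≤ k * m + (m - 1) → (k':ℕ) ≤ k := by
      intro q k k' t h1 h2
      by_contra h
      push Not at h
      have h3 : ((k:ℕ):ℝ) + 1 ≤ k' := by exact_mod_cast h
      nlinarith
    rintro q k k' t ⟨-, h1, h2⟩ ⟨-, h3, h4⟩
    exact Fin.ext (le_antisymm (key q k' k t h1 h4) (key q k k' t h3 h2))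
  · rintro q k s t ⟨-, h1, h2⟩ ⟨-, h3, h4⟩
    rw [abs_lt]
    constructor <;> nlinarith
  · intro t ht
    have key : ∀ q : Fin m, (∀ k : Fin (N+m+1), t ∉ {t | t ∈ Icc (0:ℝ) 1 ∧
        (k:ℝ) * m ≤ N * t + (m - q) ∧ N * t + (m - q) ≤ k * m + (m - 1)}) →
        ∃ k : ℤ, (k:ℝ) * m + (m - 1) < N * t + (m - q) ∧ N * t + (m - q) < k * m + m := by
      intro q hq
      have hqm : (q:ℝ) + 1 ≤ m := by exact_mod_cast q.2
      have hu : 0 ≤ N * t + (m - q) := by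
        have := mul_nonneg hN0.le ht.1
        linarith
      set k := ⌊(N * t + (m - q)) / m⌋₊ with hk
      have h1 : (k:ℝ) * m ≤ N * t + (m - q) := by
        rw [← le_div_iff₀ hm']; exact Nat.floor_le (by positivity)
      have h2 : N * t + (m - q) < k * m + m := by
        have := Nat.lt_floor_add_one ((N * t + (m - q)) / m)
        rw [← hk, div_lt_iff₀ hm'] at this
        linarith
      have h3 : k < N + m + 1 := by
        have h5 : (k:ℝ) ≤ N + m := by
          have : (N:ℝ) * t ≤ N := by nlinarith [ht.2]
          have h6 : (1:ℝ) ≤ m := by exact_mod_cast hm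
          have h7 : (k:ℝ) ≤ k * m := le_mul_of_one_le_right (by positivity) h6
          have h8 : (0:ℝ) ≤ q := by positivity
          linarith
        have : k ≤ N + m := by exact_mod_cast h5
        omega
      refine ⟨k, ?_, by simpa using h2⟩
      have := hq ⟨k, h3⟩
      simp only [mem_ofPred_eq, not_and, not_le] at this
      simpa using this ht h1
    intro q q' hq hq'
    obtain ⟨k, h1, h2⟩ := key q hq
    obtain ⟨k', h3, h4⟩ := key q' hq'
    have e1 : (((k' - k) * m - 1 : ℤ) : ℝ) < ((q:ℤ) - (q':ℤ) : ℤ) := by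
      push_cast; linarith
    have e2 : (((q:ℤ) - (q':ℤ) : ℤ) : ℝ) < (((k' - k) * m + 1 : ℤ) : ℝ) := by
      push_cast; linarith
    have e1 := Int.cast_lt.1 e1
    have e2 := Int.cast_lt.1 e2
    have e3 : (q:ℤ) - q' = (k' - k) * m := by omega
    have hq1 := q.2
    have hq2 := q'.2
    have e4 : (k' - k) = 0 := by
      by_contra hne
      rcases lt_or_gt_of_ne hne with h | h
      · have : (k' - k) * m ≤ -1 * (m:ℤ) := mul_le_mul_of_nonneg_right (by omega) (by omega)
        omega
      · have : 1 * (m:ℤ) ≤ (k' - k) * m := mul_le_mul_of_nonneg_right (by omega) (by omega)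
        omega
    rw [e4] at e3
    apply Fin.ext
    omega

lemma distinct (d K : ℕ) (t : Fin d → Fin K → ℝ) (η : ℝ) (hη : 0 < η) :
    ∃ v : Fin d → Fin K → ℝ, (∀ p k, |v p k - t p k| ≤ η) ∧
      Function.Injective (fun κ : Fin d → Fin K => ∑ p, v p (κ p)) := by
  rcases Nat.eq_zero_or_pos K with rfl | hK
  · refine ⟨t, fun p k => k.elim0, ?_⟩
    intro a b _
    funext p
    exact (a p).elim0
  set L : ℕ := K ^ d with hL
  have hLpos : (0:ℝ) < L := by positivity
  set s : ℝ := η / L with hs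
  have hspos : 0 < s := by positivity
  have hsL : s * L = η := by rw [hs]; field_simp
  refine ⟨fun p k => s * (L * ⌊t p k / η⌋ + (k:ℕ) * K ^ (p:ℕ)), ?_, ?_⟩
  · intro p k
    have h1 := Int.floor_le (t p k / η)
    have h2 := Int.lt_floor_add_one (t p k / η)
    rw [le_div_iff₀ hη] at h1
    rw [div_lt_iff₀ hη] at h2
    have h3 : ((k:ℕ):ℝ) * K ^ (p:ℕ) ≤ L := by
      have : (k:ℕ) * K ^ (p:ℕ) ≤ L := by
        calc (k:ℕ) * K ^ (p:ℕ) ≤ K * K ^ (p:ℕ) := Nat.mul_le_mul_right _ k.2.le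
          _ = K ^ ((p:ℕ)+1) := by ring
          _ ≤ K ^ d := Nat.pow_le_pow_right hK p.2
      exact_mod_cast this
    have h4 : s * (((k:ℕ):ℝ) * K ^ (p:ℕ)) ≤ η := by
      rw [← hsL]; exact mul_le_mul_of_nonneg_left h3 hspos.le
    have h5 : 0 ≤ s * (((k:ℕ):ℝ) * K ^ (p:ℕ)) := by positivity
    have h6 : s * ((L:ℝ) * ⌊t p k / η⌋ + (k:ℕ) * K ^ (p:ℕ)) =
      ⌊t p k / η⌋ * η + s * (((k:ℕ):ℝ) * K ^ (p:ℕ)) := by rw [← hsL]; ring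
    change |s * ((L:ℝ) * ⌊t p k / η⌋ + (k:ℕ) * K ^ (p:ℕ)) - t p k| ≤ η
    rw [h6, abs_le]
    constructor <;> linarith
  · intro a b hab
    simp only [← Finset.mul_sum] at hab
    have hab := mul_left_cancel₀ hspos.ne' hab
    simp only [Finset.sum_add_distrib, ← Finset.mul_sum] at hab
    have h1 : ((L:ℤ) * ∑ p, ⌊t p (a p) / η⌋ + (finFunctionFinEquiv a : ℕ) : ℤ) =
        (L:ℤ) * ∑ p, ⌊t p (b p) / η⌋ + (finFunctionFinEquiv b : ℕ) := by
      rw [finFunctionFinEquiv_apply, finFunctionFinEquiv_apply]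
      have : (((L:ℤ) * ∑ p, ⌊t p (a p) / η⌋ + ((∑ i : Fin d, (a i : ℕ) * K ^ (i:ℕ) : ℕ) : ℤ) : ℤ) : ℝ) =
        (((L:ℤ) * ∑ p, ⌊t p (b p) / η⌋ + ((∑ i : Fin d, (b i : ℕ) * K ^ (i:ℕ) : ℕ) : ℤ) : ℤ) : ℝ) := by
        push_cast
        exact hab
      exact Int.cast_injective this
    have ha := (finFunctionFinEquiv a).2
    have hb := (finFunctionFinEquiv b).2
    have h2 := congrArg (· % (L:ℤ)) h1
    simp only [Int.mul_add_emod_self_left] at h2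
    rw [Int.emod_eq_of_lt (by positivity) (by exact_mod_cast ha),
      Int.emod_eq_of_lt (by positivity) (by exact_mod_cast hb)] at h2
    exact finFunctionFinEquiv.injective (Fin.ext (by exact_mod_cast h2))

lemma plateau (K : ℕ) (J : Fin K → Set ℝ) (hJ : ∀ k, IsClosed (J k))
    (hdis : ∀ k k' t, t ∈ J k → t ∈ J k' → k = k') (φ : ℝ → ℝ) (hφ : Continuous φ)
    (v : Fin K → ℝ) (η : ℝ) (hη : 0 ≤ η) (hv : ∀ k, ∀ t ∈ J k, |v k - φ t| ≤ η) :
    ∃ ψ : ℝ → ℝ, Continuous ψ ∧ (∀ t, |ψ t - φ t| ≤ η) ∧ ∀ k, ∀ t ∈ J k, ψ t = v k := by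
  classical
  let F : ℝ → ℝ := fun t => if h : ∃ k, t ∈ J k then v h.choose - φ t else 0
  have hF : ∀ k, ∀ t ∈ J k, F t = v k - φ t := by
    intro k t ht
    have h : ∃ k, t ∈ J k := ⟨k, ht⟩
    simp only [F, dif_pos h]
    rw [hdis _ _ t h.choose_spec ht]
  have hc : ContinuousOn F (⋃ k, J k) := by
    apply (locallyFinite_of_finite J).continuousOn_iUnion hJ
    intro k
    refine ContinuousOn.congr (f := fun t => v k - φ t) (by fun_prop) (hF k)
  let G : C((⋃ k, J k : Set ℝ), ℝ) := ⟨_, continuousOn_iff_continuous_domRestrict.mp hc⟩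
  obtain ⟨g, hg1, hg2⟩ := G.exists_restrict_eq_forall_mem_of_closed (t := Icc (-η) η) (by
    rintro ⟨x, hx⟩
    obtain ⟨k, hk⟩ := mem_iUnion.1 hx
    change F x ∈ _
    rw [hF k x hk]
    exact abs_le.1 (hv k x hk)) ⟨0, by simp [hη]⟩ (isClosed_iUnion_of_finite hJ)
  refine ⟨fun t => φ t + g t, by fun_prop, ?_, ?_⟩
  · intro t
    simpa using abs_le.2 (hg1 t)
  · intro k t ht
    have := DFunLike.congr_fun hg2 ⟨t, mem_iUnion.2 ⟨k, ht⟩⟩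
    have h2 : g t = F t := this
    simp [h2, hF k t ht]

lemma interp {ι : Type*} [Fintype ι] (y : ι → ℝ) (hy : Function.Injective y)
    (a : ι → ℝ) (b : ℝ) (hb : 0 ≤ b) (ha : ∀ i, |a i| ≤ b) :
    ∃ g : ℝ → ℝ, Continuous g ∧ (∀ t, |g t| ≤ b) ∧ ∀ i, g (y i) = a i := by
  classical
  let P := Lagrange.interpolate Finset.univ y a
  refine ⟨fun t => max (-b) (min b (P.eval t)), by fun_prop, ?_, ?_⟩
  · intro t
    rw [abs_le]
    exact ⟨le_max_left _ _, max_le (by linarith) (min_le_left _ _)⟩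
  · intro i
    have : P.eval (y i) = a i :=
      Lagrange.eval_interpolate_at_node a (hy.injOn) (Finset.mem_univ i)
    have h := abs_le.1 (ha i)
    simp only [this]
    rw [min_eq_right h.2, max_eq_right h.1]

lemma KL (d : ℕ) (h : (Fin d → ℝ) → ℝ) (hh : Continuous h) (B : ℝ) (hB : 0 < B)
    (hhB : ∀ x ∈ Set.univ.pi fun _ : Fin d => Icc (0:ℝ) 1, |h x| ≤ B)
    (φ : Fin (2*d+1) → Fin d → ℝ → ℝ) (hφ : ∀ q p, Continuous (φ q p))
    (η κ : ℝ) (hη : 0 < η) (hκ : 0 < κ) :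
    ∃ (ψ : Fin (2*d+1) → Fin d → ℝ → ℝ) (g : Fin (2*d+1) → ℝ → ℝ),
      (∀ q p, Continuous (ψ q p)) ∧ (∀ q, Continuous (g q)) ∧
      (∀ q p t, |ψ q p t - φ q p t| ≤ η) ∧
      ∀ x ∈ Set.univ.pi fun _ : Fin d => Icc (0:ℝ) 1,
        |h x - ∑ q, g q (∑ p, ψ q p (x p))| ≤ d / (d+1) * B + κ := by
  classical
  have hcomp : IsCompact (Set.univ.pi fun _ : Fin d => Icc (0:ℝ) 1) :=
    isCompact_univ_pi fun _ => isCompact_Icc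
  obtain ⟨δ1, hδ1, huc⟩ := Metric.uniformContinuousOn_iff.1
    (hcomp.uniformContinuousOn_of_continuous hh.continuousOn) κ hκ
  have hφu : ∃ δ2 > 0, ∀ q p, ∀ s ∈ Icc (0:ℝ) 1, ∀ t ∈ Icc (0:ℝ) 1, |s - t| < δ2 →
      |φ q p s - φ q p t| < η / 2 := by
    have : ∀ qp : Fin (2*d+1) × Fin d, ∃ δ2 > 0, ∀ s ∈ Icc (0:ℝ) 1, ∀ t ∈ Icc (0:ℝ) 1,
        |s - t| < δ2 → |φ qp.1 qp.2 s - φ qp.1 qp.2 t| < η / 2 := fun qp =>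
      Metric.uniformContinuousOn_iff.1 (isCompact_Icc.uniformContinuousOn_of_continuous
        (hφ qp.1 qp.2).continuousOn) (η/2) (by positivity)
    choose e he1 he2 using this
    obtain ⟨δ2, hδ2, hle⟩ : ∃ δ2 > 0, ∀ qp, δ2 ≤ e qp := by
      have hev : ∀ᶠ δ in 𝓝[>] (0:ℝ), ∀ qp, δ ≤ e qp := by
        rw [eventually_all]
        exact fun qp => mem_nhdsWithin_of_mem_nhds (Iic_mem_nhds (he1 qp))
      obtain ⟨δ, h1, h2⟩ := (hev.and self_mem_nhdsWithin).exists
      exact ⟨δ, h2, h1⟩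
    exact ⟨δ2, hδ2, fun q p s hs t ht hst => he2 (q,p) s hs t ht (hst.trans_le (hle _))⟩
  obtain ⟨δ2, hδ2, hφu⟩ := hφu
  obtain ⟨K, J, hJc, hJI, hJd, hJs, hJb⟩ := cells (2*d+1) (by omega) (min δ1 δ2) (by positivity)
  -- base points
  let τ : Fin (2*d+1) → Fin K → ℝ := fun q k => if hne : (J q k).Nonempty then hne.some else 0
  have hτ1 : ∀ q k t, t ∈ J q k → τ q k ∈ J q k := by
    intro q k t ht
    have hne : (J q k).Nonempty := ⟨t, ht⟩
    simp only [τ, dif_pos hne]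
    exact hne.some_mem
  have hτ2 : ∀ q k, τ q k ∈ Icc (0:ℝ) 1 := by
    intro q k
    by_cases hne : (J q k).Nonempty
    · exact hJI q k (hτ1 q k _ hne.some_mem)
    · simp [τ, dif_neg hne]
  choose v hv1 hv2 using fun q => distinct d K (fun p k => φ q p (τ q k)) (η/2) (by positivity)
  have hpl : ∀ q p, ∃ ψ : ℝ → ℝ, Continuous ψ ∧ (∀ t, |ψ t - φ q p t| ≤ η) ∧
      ∀ k, ∀ t ∈ J q k, ψ t = v q p k := by
    intro q p
    apply plateau K (J q) (hJc q) (hJd q) (φ q p) (hφ q p) (v q p) η hη.le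
    intro k t ht
    have h1 := hv1 q p k
    have h2 := hφu q p (τ q k) (hτ2 q k) t (hJI q k ht)
      ((hJs q k _ _ (hτ1 q k t ht) ht).trans_le (min_le_right _ _))
    calc |v q p k - φ q p t| ≤ |v q p k - φ q p (τ q k)| + |φ q p (τ q k) - φ q p t| :=
          abs_sub_le _ _ _
      _ ≤ η := by linarith
  choose ψ hψ1 hψ2 hψ3 using hpl
  have hd1 : (0:ℝ) < d + 1 := by positivity
  have hint : ∀ q, ∃ g : ℝ → ℝ, Continuous g ∧ (∀ t, |g t| ≤ B / (d+1)) ∧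
      ∀ k : Fin d → Fin K, g (∑ p, v q p (k p)) = h (fun p => τ q (k p)) / (d+1) := by
    intro q
    apply interp (fun k : Fin d → Fin K => ∑ p, v q p (k p)) (hv2 q) _ _ (by positivity)
    intro k
    rw [abs_div, abs_of_pos hd1]
    gcongr
    exact hhB _ fun p _ => hτ2 q (k p)
  choose g hg1 hg2 hg3 using hint
  refine ⟨ψ, g, hψ1, hg1, hψ2, ?_⟩
  intro x hx
  let Q : Finset (Fin (2*d+1)) := Finset.univ.filter fun q => ∀ p, ∃ k, x p ∈ J q k
  have hbad : Qᶜ.card ≤ d := by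
    have hb : ∀ q : (Qᶜ : Finset (Fin (2*d+1))), ∃ p, ∀ k, x p ∉ J q k := by
      rintro ⟨q, hq⟩
      simpa [Q] using hq
    choose b hb using hb
    have : Function.Injective b := by
      intro q q' hqq
      have h1 := hb q
      have h2 := hb q'
      rw [← hqq] at h2
      exact Subtype.ext (hJb (x (b q)) (hx _ (mem_univ _)) q q' h1 h2)
    have := Fintype.card_le_of_injective b this
    rwa [Fintype.card_coe, Fintype.card_fin] at this
  have hQ : d + 1 ≤ Q.card := by
    have := Finset.card_add_card_compl Q
    simp only [Fintype.card_fin] at this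
    omega
  obtain ⟨Q', hQ', hcard⟩ := Finset.exists_subset_card_eq hQ
  have hcard2 : Q'ᶜ.card = d := by
    rw [Finset.card_compl, hcard, Fintype.card_fin]; omega
  have hgood : ∀ q ∈ Q', |h x / (d+1) - g q (∑ p, ψ q p (x p))| ≤ κ / (d+1) := by
    intro q hq
    have hq := hQ' hq
    simp only [Q, Finset.mem_filter, Finset.mem_univ, true_and] at hq
    choose k hk using hq
    have e1 : ∑ p, ψ q p (x p) = ∑ p, v q p (k p) :=
      Finset.sum_congr rfl fun p _ => hψ3 q p (k p) (x p) (hk p)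
    rw [e1, hg3, ← sub_div, abs_div, abs_of_pos hd1]
    gcongr
    have := huc x hx (fun p => τ q (k p)) (fun p _ => hτ2 q (k p)) (by
      rw [dist_pi_lt_iff hδ1]
      intro p
      exact (hJs q (k p) _ _ (hk p) (hτ1 q (k p) _ (hk p))).trans_le (min_le_left _ _))
    exact this.le
  have hsplit : h x - ∑ q, g q (∑ p, ψ q p (x p)) =
      ∑ q ∈ Q', (h x / (d+1) - g q (∑ p, ψ q p (x p))) - ∑ q ∈ Q'ᶜ, g q (∑ p, ψ q p (x p)) := by
    rw [← Finset.sum_add_sum_compl Q', Finset.sum_sub_distrib, Finset.sum_const, hcard]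
    simp only [nsmul_eq_mul]
    push_cast
    field_simp
    ring
  rw [hsplit]
  have b1 : |∑ q ∈ Q', (h x / (d+1) - g q (∑ p, ψ q p (x p)))| ≤ κ := by
    refine (Finset.abs_sum_le_sum_abs _ _).trans ((Finset.sum_le_sum hgood).trans ?_)
    rw [Finset.sum_const, hcard, nsmul_eq_mul]
    push_cast
    apply le_of_eq; field_simp
  have b2 : |∑ q ∈ Q'ᶜ, g q (∑ p, ψ q p (x p))| ≤ d / (d+1) * B := by
    refine (Finset.abs_sum_le_sum_abs _ _).trans
      ((Finset.sum_le_sum fun q _ => hg2 q _).trans ?_)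
    rw [Finset.sum_const, hcard2, nsmul_eq_mul]
    apply le_of_eq; field_simp
  rw [abs_le] at *
  constructor <;> linarith [b1.1, b1.2, b2.1, b2.2]

lemma unifBound (d : ℕ) (φ : Fin (2*d+1) → Fin d → ℝ → ℝ) (hφ : ∀ q p, Continuous (φ q p)) :
    ∃ M : ℝ, 0 < M ∧ ∀ q, ∀ x ∈ Set.univ.pi fun _ : Fin d => Icc (0:ℝ) 1,
      |∑ p, φ q p (x p)| ≤ M := by
  have hcomp : IsCompact (Set.univ.pi fun _ : Fin d => Icc (0:ℝ) 1) :=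
    isCompact_univ_pi fun _ => isCompact_Icc
  have : ∀ q, ∃ M : ℝ, ∀ x ∈ Set.univ.pi fun _ : Fin d => Icc (0:ℝ) 1,
      |∑ p, φ q p (x p)| ≤ M := by
    intro q
    have hc : Continuous fun x : Fin d → ℝ => ∑ p, φ q p (x p) :=
      continuous_finsetSum _ fun p _ => (hφ q p).comp (continuous_apply p)
    exact hcomp.exists_bound_of_continuousOn hc.continuousOn
  choose M hM using this
  refine ⟨∑ q, |M q| + 1, by positivity, fun q x hx => (hM q x hx).trans ?_⟩
  have := Finset.single_le_sum (f := fun q => |M q|) (fun i _ => abs_nonneg _) (Finset.mem_univ q)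
  linarith [le_abs_self (M q)]

/-- perturbation of the inner functions -/
lemma perturb (d : ℕ) (φ : Fin (2*d+1) → Fin d → ℝ → ℝ) (hφ : ∀ q p, Continuous (φ q p))
    (g : Fin (2*d+1) → ℝ → ℝ) (hg : ∀ q, Continuous (g q)) (κ : ℝ) (hκ : 0 < κ) :
    ∃ η, 0 < η ∧ η ≤ 1 ∧ ∀ x ∈ Set.univ.pi fun _ : Fin d => Icc (0:ℝ) 1,
      ∀ y : Fin (2*d+1) → ℝ, (∀ q, |y q - ∑ p, φ q p (x p)| ≤ η) →
      |∑ q, g q (y q) - ∑ q, g q (∑ p, φ q p (x p))| ≤ κ := by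
  obtain ⟨M, hM0, hM⟩ := unifBound d φ hφ
  have huc : ∀ q, ∃ δ > 0, ∀ s ∈ Icc (-(M+1)) (M+1), ∀ t ∈ Icc (-(M+1)) (M+1),
        |s - t| < δ → |g q s - g q t| < κ / (2*d+1) := fun q =>
      Metric.uniformContinuousOn_iff.1 (isCompact_Icc.uniformContinuousOn_of_continuous
        (hg q).continuousOn) _ (by positivity)
  choose e he1 he2 using huc
  have hev : ∀ᶠ δ in 𝓝[>] (0:ℝ), (∀ q, δ < e q) ∧ δ ≤ 1 := by
    rw [eventually_and, eventually_all]
    exact ⟨fun q => mem_nhdsWithin_of_mem_nhds (Iio_mem_nhds (he1 q)),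
      mem_nhdsWithin_of_mem_nhds (Iic_mem_nhds one_pos)⟩
  obtain ⟨δ, ⟨h1, h2⟩, h3⟩ := (hev.and self_mem_nhdsWithin).exists
  refine ⟨δ, h3, h2, ?_⟩
  intro x hx y hy
  rw [← Finset.sum_sub_distrib]
  refine (Finset.abs_sum_le_sum_abs _ _).trans ?_
  have : ∀ q ∈ Finset.univ, |g q (y q) - g q (∑ p, φ q p (x p))| ≤ κ / (2*d+1) := by
    intro q _
    have a1 := abs_le.1 (hM q x hx)
    have a2 := abs_le.1 (hy q)
    exact (he2 q _ ⟨by linarith, by linarith⟩ _ ⟨by linarith, by linarith⟩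
      ((hy q).trans_lt (h1 q))).le
  refine (Finset.sum_le_sum this).trans ?_
  rw [Finset.sum_const, Finset.card_univ, Fintype.card_fin, nsmul_eq_mul]
  push_cast
  apply le_of_eq; field_simp

lemma kolm (d : ℕ) (f : (Fin d → ℝ) → ℝ) (hf : Continuous f) (ε : ℝ) (hε : 0 < ε) :
    ∃ (φ : Fin (2*d+1) → Fin d → ℝ → ℝ) (g : Fin (2*d+1) → ℝ → ℝ),
      (∀ q p, Continuous (φ q p)) ∧ (∀ q, Continuous (g q)) ∧
      ∀ x ∈ Set.univ.pi fun _ : Fin d => Icc (0:ℝ) 1,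
        |f x - ∑ q, g q (∑ p, φ q p (x p))| ≤ ε := by
  have hcomp : IsCompact (Set.univ.pi fun _ : Fin d => Icc (0:ℝ) 1) :=
    isCompact_univ_pi fun _ => isCompact_Icc
  obtain ⟨M', hM'⟩ := hcomp.exists_bound_of_continuousOn hf.continuousOn
  set M := max M' 1
  have hM0 : 0 < M := lt_of_lt_of_le one_pos (le_max_right _ _)
  set θ : ℝ := (2*d+1)/(2*d+2) with hθ
  have hθ0 : 0 < θ := by positivity
  have hθ1 : θ < 1 := by rw [hθ, div_lt_one (by positivity)]; linarith
  have ind : ∀ n : ℕ, ∃ (φ : Fin (2*d+1) → Fin d → ℝ → ℝ) (g : Fin (2*d+1) → ℝ → ℝ),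
      (∀ q p, Continuous (φ q p)) ∧ (∀ q, Continuous (g q)) ∧
      ∀ x ∈ Set.univ.pi fun _ : Fin d => Icc (0:ℝ) 1,
        |f x - ∑ q, g q (∑ p, φ q p (x p))| ≤ θ ^ n * M := by
    intro n
    induction n with
    | zero =>
      refine ⟨fun _ _ _ => 0, fun _ _ => 0, fun _ _ => continuous_const,
        fun _ => continuous_const, fun x hx => ?_⟩
      have h1 : |f x| ≤ M := (hM' x hx).trans (le_max_left M' 1)
      simpa using h1
    | succ n ih =>
      obtain ⟨φ, g, hφ, hg, hb⟩ := ih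
      set B := θ ^ n * M with hBdef
      have hB : 0 < B := by positivity
      set κ := B / (4 * (d+1)) with hκdef
      have hκ : 0 < κ := by positivity
      obtain ⟨η, hη0, -, hη⟩ := perturb d φ hφ g hg κ hκ
      have hh : Continuous fun x : Fin d → ℝ => f x - ∑ q, g q (∑ p, φ q p (x p)) := by
        refine hf.sub (continuous_finsetSum _ fun q _ => (hg q).comp
          (continuous_finsetSum _ fun p _ => (hφ q p).comp (continuous_apply p)))
      obtain ⟨ψ, g', hψ, hg', hclose, hKL⟩ := KL d _ hh B hB hb φ hφ (η/(d+1)) κ (by positivity) hκ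
      refine ⟨ψ, fun q t => g q t + g' q t, hψ, fun q => (hg q).add (hg' q), ?_⟩
      intro x hx
      have h1 := hKL x hx
      have h2 := hη x hx (fun q => ∑ p, ψ q p (x p)) (by
        intro q
        rw [← Finset.sum_sub_distrib]
        refine (Finset.abs_sum_le_sum_abs _ _).trans
          ((Finset.sum_le_sum fun p _ => hclose q p (x p)).trans ?_)
        rw [Finset.sum_const, Finset.card_univ, Fintype.card_fin, nsmul_eq_mul, ← mul_div_assoc,
          div_le_iff₀ (by positivity)]
        nlinarith)
      have h3 : θ ^ (n+1) * M = d / (d+1) * B + 2 * κ := by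
        rw [pow_succ, mul_right_comm, ← hBdef, hκdef, hθ]
        field_simp
        ring
      rw [h3]
      simp only [Finset.sum_add_distrib]
      rw [abs_le] at *
      constructor <;> linarith [h1.1, h1.2, h2.1, h2.2]
  obtain ⟨n, hn⟩ := exists_pow_lt_of_lt_one (div_pos hε hM0) hθ1
  obtain ⟨φ, g, hφ, hg, hb⟩ := ind n
  refine ⟨φ, g, hφ, hg, fun x hx => (hb x hx).trans ?_⟩
  rw [lt_div_iff₀ hM0] at hn
  exact hn.le

end MP

namespace MP
open Set Filter Topology

/-- The strip. -/
def strip : Set ℂ := {z | |z.im| < 1}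

lemma isOpen_strip : IsOpen strip :=
  isOpen_lt (continuous_abs.comp Complex.continuous_im) continuous_const

structure Good (S : ℝ → ℝ) : Prop where
  mono : StrictMono S
  bot : Tendsto S atBot (𝓝 0)
  top : Tendsto S atTop (𝓝 1)
  ext : ∃ F : ℂ → ℂ, DifferentiableOn ℂ F strip ∧ (∀ z ∈ strip, ‖F z‖ ≤ 1) ∧
    ∀ x : ℝ, F x = S x

lemma Good.nonneg {S : ℝ → ℝ} (h : Good S) (x : ℝ) : 0 ≤ S x :=
  h.mono.monotone.le_of_tendsto h.bot x

lemma Good.le_one {S : ℝ → ℝ} (h : Good S) (x : ℝ) : S x ≤ 1 :=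
  h.mono.monotone.ge_of_tendsto h.top x

lemma Good.analytic {S : ℝ → ℝ} (h : Good S) : AnalyticOnNhd ℝ S univ := by
  obtain ⟨F, hF, -, hFS⟩ := h.ext
  intro x _
  have h1 : AnalyticAt ℂ F (x:ℂ) :=
    hF.analyticAt (isOpen_strip.mem_nhds (by simp [strip]))
  have h2 : AnalyticAt ℝ (fun y : ℝ => (F (y:ℂ)).re) x := by
    have h3 : AnalyticAt ℝ F (Complex.ofRealCLM x) := h1.restrictScalars
    have h4 : AnalyticAt ℝ (fun y : ℝ => F (Complex.ofRealCLM y)) x :=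
      h3.comp (Complex.ofRealCLM.analyticAt x)
    exact (Complex.reCLM.analyticAt _).comp h4
  simpa [hFS] using h2

lemma Good.continuous {S : ℝ → ℝ} (h : Good S) : Continuous S :=
  continuous_iff_continuousAt.2 fun x => (h.analytic x (mem_univ x)).continuousAt

lemma good_pow (k : ℕ) : Good (fun s => Real.sigmoid s ^ (k+1)) where
  mono := fun a b hab => pow_lt_pow_left₀ (Real.sigmoid_lt hab) (Real.sigmoid_nonneg a) (by simp)
  bot := by simpa using Real.tendsto_sigmoid_atBot.pow (k+1)
  top := by simpa using Real.tendsto_sigmoid_atTop.pow (k+1)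
  ext := by
    have key : ∀ z ∈ strip, 1 ≤ ‖1 + Complex.exp (-z)‖ := by
      intro z hz
      have hz : |z.im| < 1 := hz
      have h1 : 0 ≤ (Complex.exp (-z)).re := by
        rw [Complex.exp_re]
        have := Real.pi_gt_three
        have hz := abs_lt.1 hz
        have : 0 ≤ Real.cos (-z).im := by
          apply Real.cos_nonneg_of_mem_Icc
          simp only [Complex.neg_im, mem_Icc]
          constructor <;> linarith
        positivity
      calc (1:ℝ) ≤ (1 + Complex.exp (-z)).re := by simpa using h1
        _ ≤ _ := Complex.re_le_norm _
    refine ⟨fun z => ((1 + Complex.exp (-z))⁻¹) ^ (k+1), ?_, ?_, ?_⟩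
    · refine DifferentiableOn.pow (DifferentiableOn.inv (by fun_prop) ?_) _
      intro z hz h0
      have := key z hz
      rw [h0, norm_zero] at this
      linarith
    · intro z hz
      rw [norm_pow, norm_inv]
      exact pow_le_one₀ (by positivity) (inv_le_one_of_one_le₀ (key z hz))
    · intro x
      simp [Real.sigmoid_def]

/-- Countable mixtures of translates. -/
lemma good_tsum (c : ℕ → ℝ) (hc : ∀ i, 0 ≤ c i) (hc0 : 0 < c 0) (hsum : HasSum c 1)
    (T : ℕ → ℝ → ℝ) (hT : ∀ i, Good (T i)) (n : ℕ → ℝ) :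
    Good (fun s => ∑' i, c i * T i (s - n i)) := by
  have hs : ∀ s, Summable fun i => c i * T i (s - n i) := fun s =>
    Summable.of_nonneg_of_le (fun i => mul_nonneg (hc i) ((hT i).nonneg _))
      (fun i => mul_le_of_le_one_right (hc i) ((hT i).le_one _)) hsum.summable
  constructor
  · intro a b hab
    refine Summable.tsum_lt_tsum (i := 0) (fun i => ?_) ?_ (hs a) (hs b)
    · exact mul_le_mul_of_nonneg_left ((hT i).mono.monotone (by linarith)) (hc i)
    · exact mul_lt_mul_of_pos_left ((hT 0).mono (by linarith)) hc0
  · have := tendsto_tsum_of_dominated_convergence (𝓕 := atBot)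
      (f := fun (s : ℝ) i => c i * T i (s - n i)) (g := fun i => c i * 0) (bound := c) hsum.summable
      (fun i => ((hT i).bot.comp (tendsto_atBot_add_const_right _ (-n i) tendsto_id)).const_mul _)
      (Eventually.of_forall fun s i => by
        rw [Real.norm_of_nonneg (mul_nonneg (hc i) ((hT i).nonneg _))]
        exact mul_le_of_le_one_right (hc i) ((hT i).le_one _))
    simpa using this
  · have := tendsto_tsum_of_dominated_convergence (𝓕 := atTop)
      (f := fun (s : ℝ) i => c i * T i (s - n i)) (g := fun i => c i * 1) (bound := c) hsum.summable
      (fun i => ((hT i).top.comp (tendsto_atTop_add_const_right _ (-n i) tendsto_id)).const_mul _)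
      (Eventually.of_forall fun s i => by
        rw [Real.norm_of_nonneg (mul_nonneg (hc i) ((hT i).nonneg _))]
        exact mul_le_of_le_one_right (hc i) ((hT i).le_one _))
    simpa [hsum.tsum_eq] using this
  · choose F hF1 hF2 hF3 using fun i => (hT i).ext
    have hmem : ∀ i, ∀ z ∈ strip, z - (n i : ℂ) ∈ strip := by
      intro i z hz
      simpa [strip] using hz
    have hbd : ∀ i, ∀ z ∈ strip, ‖(c i : ℂ) * F i (z - n i)‖ ≤ c i := by
      intro i z hz
      rw [norm_mul, Complex.norm_of_nonneg (hc i)]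
      exact mul_le_of_le_one_right (hc i) (hF2 i _ (hmem i z hz))
    refine ⟨fun z => ∑' i, (c i : ℂ) * F i (z - n i), ?_, ?_, ?_⟩
    · refine Complex.differentiableOn_tsum_of_summable_norm hsum.summable ?_ isOpen_strip hbd
      intro i
      refine DifferentiableOn.const_mul ?_ _
      exact (hF1 i).comp (by fun_prop) (hmem i)
    · intro z hz
      exact tsum_of_norm_bounded hsum (fun i => hbd i z hz)
    · intro x
      rw [Complex.ofReal_tsum]
      refine tsum_congr fun i => ?_
      rw [← Complex.ofReal_sub, hF3]
      push_cast
      rfl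

lemma good_combo {P N : ℝ → ℝ} (hP : Good P) (hN : Good N) (a b : ℝ) (ha : 0 < a) (hb : 0 ≤ b)
    (hab : a + b = 1) : Good (fun s => a * P s + b * N s) := by
  have h := good_tsum (fun i => if i = 0 then a else if i = 1 then b else 0)
    (by intro i; split_ifs <;> linarith) (by simpa using ha) (by
      have := hasSum_sum_of_ne_finset_zero (L := SummationFilter.unconditional ℕ)
        (f := fun i : ℕ => if i = 0 then a else if i = 1 then b else 0) (s := Finset.range 2) (by
          intro i hi
          simp only [Finset.mem_range, not_lt] at hi
          rw [if_neg (by omega), if_neg (by omega)])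
      simpa [Finset.sum_range_succ, hab] using this)
    (fun i => if i = 0 then P else N) (by intro i; split_ifs <;> assumption) (fun _ => 0)
  convert h using 2 with s
  rw [tsum_eq_sum (s := Finset.range 2)]
  · simp [Finset.sum_range_succ]
  · intro i hi
    simp only [Finset.mem_range, not_lt] at hi
    rw [if_neg (by omega), if_neg (by omega), zero_mul]

def Cone (h : ℝ → ℝ) : Prop := ∃ A C : ℝ, ∃ P, 0 ≤ A ∧ Good P ∧ ∀ s, h s = A * P s + C

lemma cone_const (c : ℝ) : Cone (fun _ => c) :=
  ⟨0, c, _, le_rfl, good_pow 0, fun s => by simp⟩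

lemma cone_add {h k : ℝ → ℝ} (hh : Cone h) (hk : Cone k) : Cone (fun s => h s + k s) := by
  obtain ⟨A, C, P, hA, hP, e⟩ := hh
  obtain ⟨A', C', P', hA', hP', e'⟩ := hk
  rcases hA.eq_or_lt with rfl | hA
  · exact ⟨A', C + C', P', hA', hP', fun s => by simp only [e, e']; ring⟩
  · have h0 : 0 < A + A' := by linarith
    refine ⟨A + A', C + C', _, h0.le, good_combo hP hP' (A/(A+A')) (A'/(A+A')) (by positivity)
      (by positivity) (by field_simp), fun s => ?_⟩
    simp only [e, e']
    field_simp
    ring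

lemma poly_cone (p : Polynomial ℝ) : ∃ h k : ℝ → ℝ, Cone h ∧ Cone k ∧
    ∀ s, p.eval (Real.sigmoid s) = h s - k s := by
  induction p using Polynomial.induction_on' with
  | add p q hp hq =>
    obtain ⟨h, k, hh, hk, e⟩ := hp
    obtain ⟨h', k', hh', hk', e'⟩ := hq
    refine ⟨_, _, cone_add hh hh', cone_add hk hk', fun s => ?_⟩
    rw [Polynomial.eval_add, e, e']
    ring
  | monomial n a =>
    rcases n with _ | n
    · exact ⟨_, _, cone_const a, cone_const 0, fun s => by simp⟩
    · refine ⟨_, _, ⟨max a 0, 0, _, le_max_right _ _, good_pow n, fun s => rfl⟩,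
        ⟨max (-a) 0, 0, _, le_max_right _ _, good_pow n, fun s => rfl⟩, fun s => ?_⟩
      simp only [Polynomial.eval_monomial, add_zero]
      rw [← sub_mul]
      congr 1
      rcases le_total 0 a with h | h
      · rw [max_eq_left h, max_eq_right (by linarith)]; ring
      · rw [max_eq_right h, max_eq_left (by linarith)]; ring

lemma dense_good (g : ℝ → ℝ) (hg : Continuous g) (ε : ℝ) (hε : 0 < ε) :
    ∃ (P N : ℝ → ℝ) (A B C : ℝ), Good P ∧ Good N ∧ 
      ∀ s ∈ Icc (-1:ℝ) 1, |g s - (A * P s + B * N s + C)| < ε := by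
  have hlog : ∀ s, -(Real.log ((Real.sigmoid s)⁻¹ - 1)) = s := by
    intro s
    simp [Real.sigmoid_def]
  have hc : ContinuousOn (fun u => g (-(Real.log (u⁻¹ - 1))))
      (Icc (Real.sigmoid (-1)) (Real.sigmoid 1)) := by
    refine hg.comp_continuousOn (ContinuousOn.neg (ContinuousOn.log ?_ ?_))
    · refine ContinuousOn.sub (ContinuousOn.inv₀ continuousOn_id ?_) continuousOn_const
      intro u hu
      exact ((Real.sigmoid_pos _).trans_le hu.1).ne'
    · intro u hu
      have h0 : 0 < u := (Real.sigmoid_pos _).trans_le hu.1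
      have h1 : u < 1 := hu.2.trans_lt (Real.sigmoid_lt_one _)
      have := (one_lt_inv₀ h0).2 h1
      linarith
  obtain ⟨p, hp⟩ := exists_polynomial_near_of_continuousOn _ _ _ hc ε hε
  obtain ⟨h, k, ⟨A, C, P, -, hP, e⟩, ⟨A', C', P', -, hP', e'⟩, hpe⟩ := poly_cone p
  refine ⟨P, P', A, -A', C - C', hP, hP', fun s hs => ?_⟩
  have := hp (Real.sigmoid s) ⟨Real.sigmoid_le hs.1, Real.sigmoid_le hs.2⟩
  simp only [hlog] at this
  rw [hpe, e, e', abs_sub_comm] at this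
  convert this using 2
  ring

lemma exists_seq : ∃ T : ℕ → ℝ → ℝ, (∀ i, Good (T i)) ∧
    ∀ P, Good P → ∀ ε > 0, ∀ m : ℕ, ∃ i ≥ m, ∀ s ∈ Icc (-1:ℝ) 1, |T i s - P s| < ε := by
  let D := {u : C(Icc (-1:ℝ) 1, ℝ) // ∃ S, Good S ∧ ∀ s : Icc (-1:ℝ) 1, u s = S s}
  have mk : ∀ P, Good P → ∃ u : D, ∀ s : Icc (-1:ℝ) 1, u.1 s = P s := fun P hP =>
    ⟨⟨⟨fun s => P s, hP.continuous.comp continuous_subtype_val⟩, P, hP, fun s => rfl⟩, fun s => rfl⟩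
  have : Nonempty D := ⟨(mk _ (good_pow 0)).choose⟩
  obtain ⟨u, hu⟩ := TopologicalSpace.exists_dense_seq D
  choose S hS1 hS2 using fun i => (u i).2
  refine ⟨fun i => S i.unpair.1, fun i => hS1 _, ?_⟩
  intro P hP ε hε m
  obtain ⟨v, hv⟩ := mk P hP
  obtain ⟨i, hi⟩ := hu.exists_dist_lt v hε
  refine ⟨Nat.pair i m, Nat.right_le_pair i m, fun s hs => ?_⟩
  simp only [Nat.unpair_pair]
  have h1 := (ContinuousMap.dist_lt_iff hε).1 (show dist v.1 (u i).1 < ε from hi) ⟨s, hs⟩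
  rw [hv, hS2, Real.dist_eq, abs_sub_comm] at h1
  exact h1

lemma exists_sigma : ∃ σ : ℝ → ℝ, Good σ ∧ ∀ P, Good P → ∀ δ > 0, ∃ A n C : ℝ,
    ∀ s ∈ Icc (-1:ℝ) 1, |P s - (A * σ (s + n) + C)| < δ := by
  obtain ⟨T, hT, hTd⟩ := exists_seq
  let c : ℕ → ℝ := fun i => 1 / 2 / 2 ^ i
  have hcpos : ∀ i, 0 < c i := fun i => by positivity
  have hcsum : HasSum c 1 := hasSum_geometric_two' 1
  let e : ℕ → ℝ := fun i => c i / (i + 1)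
  have hepos : ∀ i, 0 < e i := fun i => div_pos (hcpos i) (by positivity)
  have heanti : ∀ i j, i ≤ j → e j ≤ e i := by
    intro i j hij
    simp only [e, c]
    gcongr
    norm_num
  have hρ : ∀ j, ∃ ρ : ℝ, 0 ≤ ρ ∧ (∀ i ≤ j, ∀ x ≥ ρ, 1 - T i x ≤ e j) ∧
      ∀ x ≤ -ρ, T j x ≤ e j := by
    intro j
    have h1 : ∀ᶠ x in atTop, ∀ i ∈ Finset.range (j+1), 1 - e j ≤ T i x := by
      rw [Filter.eventually_all_finset]
      intro i _
      exact ((hT i).top.eventually (lt_mem_nhds (by linarith [hepos j]))).mono fun x hx => le_of_lt hx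
    have h2 : ∀ᶠ x in atTop, T j (-x) ≤ e j :=
      (((hT j).bot.comp tendsto_neg_atTop_atBot).eventually
        (gt_mem_nhds (hepos j))).mono fun x hx => le_of_lt hx
    obtain ⟨ρ, h3, h4, h5⟩ := (h1.and (h2.and (eventually_ge_atTop 0))).exists
    refine ⟨ρ, h5, ?_, ?_⟩
    · intro i hi x hx
      have := h3 i (Finset.mem_range.2 (by omega))
      linarith [(hT i).mono.monotone hx]
    · intro x hx
      exact ((hT j).mono.monotone hx).trans h4
  choose ρ hρ0 hρ1 hρ2 using hρ
  let n : ℕ → ℝ := fun j => ∑ l ∈ Finset.range (j+1), (ρ l + 1)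
  have hn : ∀ i j, i < j → n i + ρ j + 1 ≤ n j := by
    intro i j hij
    simp only [n]
    rw [Finset.sum_range_succ _ j]
    have : ∑ l ∈ Finset.range (i+1), (ρ l + 1) ≤ ∑ l ∈ Finset.range j, (ρ l + 1) :=
      Finset.sum_le_sum_of_subset_of_nonneg (Finset.range_mono (by omega))
        fun l _ _ => by linarith [hρ0 l]
    linarith
  refine ⟨_, good_tsum c (fun i => (hcpos i).le) (hcpos 0) hcsum T hT n, ?_⟩
  have hs : ∀ s, Summable fun i => c i * T i (s - n i) := fun s =>
    Summable.of_nonneg_of_le (fun i => mul_nonneg (hcpos i).le ((hT i).nonneg _))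
      (fun i => mul_le_of_le_one_right (hcpos i).le ((hT i).le_one _)) hcsum.summable
  have key : ∀ j, ∃ C, ∀ s ∈ Icc (-1:ℝ) 1,
      |(∑' i, c i * T i (s + n j - n i)) - C - c j * T j s| ≤ e j := by
    intro j
    have hsm : Summable fun i => if i < j then c i else 0 :=
      Summable.of_nonneg_of_le (fun i => by split_ifs <;> [exact (hcpos i).le; exact le_rfl])
        (fun i => by split_ifs <;> [exact le_rfl; exact (hcpos i).le]) hcsum.summable
    refine ⟨∑' i, if i < j then c i else 0, fun s hs1 => ?_⟩
    have H := ((hs (s + n j)).hasSum.sub hsm.hasSum).sub (hasSum_ite_eq j (c j * T j s))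
    rw [← H.tsum_eq, ← Real.norm_eq_abs]
    have hb : HasSum (fun i => c i * e j) (e j) := by simpa using hcsum.mul_right (e j)
    refine tsum_of_norm_bounded hb ?_
    intro i
    have hTn := (hT i).nonneg (s + n j - n i)
    have hT1 := (hT i).le_one (s + n j - n i)
    have hci := hcpos i
    have hej := hepos j
    rcases lt_trichotomy i j with h | h | h
    · rw [if_pos h, if_neg h.ne, Real.norm_eq_abs, abs_le]
      have h1 := hρ1 j i h.le (s + n j - n i) (by linarith [hn i j h, hs1.1])
      constructor <;> nlinarith
    · subst h
      simp only [lt_irrefl, if_false, if_true, add_sub_cancel_right, sub_zero, sub_self, norm_zero]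
      positivity
    · rw [if_neg h.not_gt, if_neg h.ne', Real.norm_eq_abs, abs_le]
      have h1 := hρ2 i (s + n j - n i) (by linarith [hn j i h, hs1.2])
      have h2 := heanti j i h.le
      constructor <;> nlinarith
  intro P hP δ hδ
  obtain ⟨m, hm⟩ := exists_nat_gt (2 / δ)
  obtain ⟨j, hj, hjT⟩ := hTd P hP (δ/2) (by positivity) m
  obtain ⟨C, hC⟩ := key j
  refine ⟨(c j)⁻¹, n j, -(C / c j), fun s hs1 => ?_⟩
  have h1 := hC s hs1
  have h2 := hjT s hs1
  have hcj := hcpos j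
  set X := ∑' i, c i * T i (s + n j - n i) with hX
  have h3 : |(c j)⁻¹ * X + -(C / c j) - T j s| ≤ 1 / (j+1) := by
    have : (c j)⁻¹ * X + -(C / c j) - T j s = (X - C - c j * T j s) / c j := by
      field_simp; ring
    rw [this, abs_div, abs_of_pos hcj, div_le_iff₀ hcj]
    refine h1.trans (le_of_eq ?_)
    simp only [e]; ring
  have h4 : 1 / ((j:ℝ)+1) < δ / 2 := by
    have : (m:ℝ) ≤ j := by exact_mod_cast hj
    rw [div_lt_iff₀ hδ] at hm
    rw [div_lt_iff₀ (by positivity)]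
    nlinarith
  rw [abs_le] at h3
  rw [abs_lt] at *
  constructor <;> linarith [h3.1, h3.2, h2.1, h2.2]

lemma exists_sigma3 : ∃ σ : ℝ → ℝ, Good σ ∧ ∀ (g : ℝ → ℝ), Continuous g → ∀ R > 0, ∀ ε > 0,
    ∃ c w θ : Fin 3 → ℝ, ∀ t ∈ Icc (-R) R, |g t - ∑ i, c i * σ (w i * t - θ i)| < ε := by
  obtain ⟨σ, hσ, H⟩ := exists_sigma
  refine ⟨σ, hσ, fun g hg R hR ε hε => ?_⟩
  obtain ⟨P, N, A, B, C, hP, hN, h1⟩ := dense_good (fun s => g (R * s)) (by fun_prop) (ε/2)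
    (by positivity)
  obtain ⟨a, n, c, h2⟩ := H P hP (ε / (4 * (|A| + 1))) (by positivity)
  obtain ⟨a', n', c', h3⟩ := H N hN (ε / (4 * (|B| + 1))) (by positivity)
  have hσ0 : 0 < σ 0 := (hσ.nonneg (-1)).trans_lt (hσ.mono (by norm_num))
  refine ⟨![A * a, B * a', (A * c + B * c' + C) / σ 0], ![1/R, 1/R, 0], ![-n, -n', 0], ?_⟩
  intro t ht
  have hs : t / R ∈ Icc (-1:ℝ) 1 := by
    constructor
    · rw [le_div_iff₀ hR]; linarith [ht.1]
    · rw [div_le_iff₀ hR]; linarith [ht.2]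
  have k1 := h1 _ hs
  have k2 := h2 _ hs
  have k3 := h3 _ hs
  have eR : R * (t / R) = t := by field_simp
  simp only [eR] at k1
  have aux : ∀ A x : ℝ, |x| < ε / (4 * (|A| + 1)) → |A * x| ≤ ε / 4 := by
    intro A x hx
    rw [abs_mul]
    rw [lt_div_iff₀ (by positivity)] at hx
    nlinarith [abs_nonneg A, abs_nonneg x]
  have k2 := aux A _ k2
  have k3 := aux B _ k3
  have e1 : ∑ i, (![A * a, B * a', (A * c + B * c' + C) / σ 0] : Fin 3 → ℝ) i *
      σ ((![1/R, 1/R, 0] : Fin 3 → ℝ) i * t - (![-n, -n', 0] : Fin 3 → ℝ) i) =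
      A * a * σ (t / R + n) + B * a' * σ (t / R + n') + (A * c + B * c' + C) := by
    simp only [Fin.sum_univ_three, Matrix.cons_val]
    rw [show 1 / R * t - -n = t / R + n by ring, show 1 / R * t - -n' = t / R + n' by ring,
      show 0 * t - 0 = (0:ℝ) by ring]
    field_simp
  rw [e1]
  rw [abs_le] at k2 k3
  rw [abs_lt] at *
  constructor <;> linarith [k1.1, k1.2, k2.1, k2.2, k3.1, k3.2]

end MP

namespace MP
open Set Filter Topology

lemma final (σ : ℝ → ℝ) (H : ∀ (g : ℝ → ℝ), Continuous g → ∀ R > 0, ∀ ε > 0,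
    ∃ c w θ : Fin 3 → ℝ, ∀ t ∈ Icc (-R) R, |g t - ∑ i, c i * σ (w i * t - θ i)| < ε)
    (d : ℕ) (f : (Fin d → ℝ) → ℝ) (hf : Continuous f) (ε : ℝ) (hε : 0 < ε) :
    ∃ (D W Γ : Fin (2*d+1) → Fin 3 → ℝ) (c w θ : Fin (2*d+1) → Fin d → Fin 3 → ℝ),
      ∀ x ∈ Set.univ.pi fun _ : Fin d => Icc (0:ℝ) 1,
        |f x - ∑ q, ∑ r, D q r * σ (W q r * (∑ p, ∑ u, c q p u * σ (w q p u * x p - θ q p u))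
          - Γ q r)| < ε := by
  obtain ⟨φ, g, hφ, hg, h1⟩ := kolm d f hf (ε/4) (by positivity)
  obtain ⟨M, hM0, hM⟩ := unifBound d φ hφ
  obtain ⟨η, hη0, hη1, hη⟩ := perturb d φ hφ g hg (ε/4) (by positivity)
  choose D W Γ hD using fun q => H (g q) (hg q) (M+1) (by positivity) (ε/(4*(2*d+1))) (by positivity)
  choose c w θ hc using fun q p => H (φ q p) (hφ q p) 1 one_pos (η/(d+1)) (by positivity)
  refine ⟨D, W, Γ, c, w, θ, fun x hx => ?_⟩
  set y : Fin (2*d+1) → ℝ := fun q => ∑ p, ∑ u, c q p u * σ (w q p u * x p - θ q p u) with hy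
  have hyb : ∀ q, |y q - ∑ p, φ q p (x p)| ≤ η := by
    intro q
    rw [hy, ← Finset.sum_sub_distrib]
    have hb : ∀ p ∈ Finset.univ, |∑ u, c q p u * σ (w q p u * x p - θ q p u) - φ q p (x p)|
        ≤ η / (d+1) := by
      intro p _
      have hxp := hx p (mem_univ p)
      rw [abs_sub_comm]
      exact (hc q p (x p) ⟨by linarith [hxp.1], hxp.2⟩).le
    refine (Finset.abs_sum_le_sum_abs _ _).trans ((Finset.sum_le_sum hb).trans ?_)
    rw [Finset.sum_const, Finset.card_univ, Fintype.card_fin, nsmul_eq_mul, ← mul_div_assoc,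
      div_le_iff₀ (by positivity)]
    nlinarith
  have h2 := hη x hx y hyb
  have h3 : |∑ q, g q (y q) - ∑ q, ∑ r, D q r * σ (W q r * y q - Γ q r)| ≤ ε / 4 := by
    rw [← Finset.sum_sub_distrib]
    have hb : ∀ q ∈ Finset.univ, |g q (y q) - ∑ r, D q r * σ (W q r * y q - Γ q r)|
        ≤ ε/(4*(2*d+1)) := by
      intro q _
      have a1 := abs_le.1 (hM q x hx)
      have a2 := abs_le.1 (hyb q)
      exact (hD q (y q) ⟨by linarith, by linarith⟩).le
    refine (Finset.abs_sum_le_sum_abs _ _).trans ((Finset.sum_le_sum hb).trans ?_)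
    rw [Finset.sum_const, Finset.card_univ, Fintype.card_fin, nsmul_eq_mul]
    push_cast
    apply le_of_eq; field_simp
  have h1 := h1 x hx
  rw [abs_le] at h1 h2 h3
  rw [abs_lt]
  constructor <;> linarith [h1.1, h1.2, h2.1, h2.2, h3.1, h3.2]

end MP

/-- **Maiorov–Pinkus.** There exists an activation function `σ : ℝ → ℝ` which is
real-analytic, strictly increasing and sigmoidal (`σ → 0` at `−∞`, `σ → 1` at
`+∞`) such that for every `d ≥ 1`, every continuous `f` on `[0,1]^d` and every
`ε > 0` there is a two-hidden-layer network with `3d` units in the first hidden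
layer and `6d+3` units in the second approximating `f` uniformly on `[0,1]^d`
within `ε`. -/
theorem maiorov_pinkus_two_layer :
    ∃ σ : ℝ → ℝ,
      AnalyticOnNhd ℝ σ Set.univ ∧ StrictMono σ ∧
      Filter.Tendsto σ Filter.atBot (nhds 0) ∧
      Filter.Tendsto σ Filter.atTop (nhds 1) ∧
      ∀ d : ℕ, 1 ≤ d →
        ∀ f : (Fin d → ℝ) → ℝ,
          ContinuousOn f (Set.univ.pi fun _ => Set.Icc 0 1) →
          ∀ ε : ℝ, 0 < ε →
            ∃ (dc : Fin (6 * d + 3) → ℝ) (c : Fin (6 * d + 3) → Fin (3 * d) → ℝ)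
              (θ : Fin (6 * d + 3) → Fin (3 * d) → ℝ) (γ : Fin (6 * d + 3) → ℝ)
              (w : Fin (6 * d + 3) → Fin (3 * d) → (Fin d → ℝ)),
              ∀ x ∈ Set.univ.pi fun _ : Fin d => Set.Icc (0 : ℝ) 1,
                |f x - ∑ i, dc i *
                    σ (∑ j, c i j * σ ((∑ k, w i j k * x k) - θ i j) - γ i)| < ε := by
  obtain ⟨σ, hσ, H⟩ := MP.exists_sigma3
  refine ⟨σ, hσ.analytic, hσ.mono, hσ.bot, hσ.top, ?_⟩
  intro d _ f hf ε hε
  have hcl : Continuous fun x : Fin d → ℝ => fun i => max 0 (min 1 (x i)) := by fun_prop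
  have hfc : Continuous fun x : Fin d → ℝ => f (fun i => max 0 (min 1 (x i))) := by
    refine hf.comp_continuous hcl ?_
    intro x i _
    exact ⟨le_max_left _ _, max_le zero_le_one (min_le_left _ _)⟩
  obtain ⟨D, W, Γ, c, w, θ, h⟩ := MP.final σ H d _ hfc ε hε
  let e1 : Fin (6 * d + 3) ≃ Fin (2 * d + 1) × Fin 3 :=
    (finCongr (by ring)).trans (finProdFinEquiv (m := 2 * d + 1) (n := 3)).symm
  let e2 : Fin (3 * d) ≃ Fin d × Fin 3 :=
    (finCongr (by ring)).trans (finProdFinEquiv (m := d) (n := 3)).symm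
  refine ⟨fun i => D (e1 i).1 (e1 i).2,
    fun i j => W (e1 i).1 (e1 i).2 * c (e1 i).1 (e2 j).1 (e2 j).2,
    fun i j => θ (e1 i).1 (e2 j).1 (e2 j).2, fun i => Γ (e1 i).1 (e1 i).2,
    fun i j => Pi.single (e2 j).1 (w (e1 i).1 (e2 j).1 (e2 j).2), ?_⟩
  intro x hx
  have hx1 : (fun i => max 0 (min 1 (x i))) = x := by
    funext i
    have := hx i (Set.mem_univ i)
    rw [min_eq_right this.2, max_eq_right this.1]
  have h1 := h x hx
  rw [hx1] at h1
  convert h1 using 3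
  rw [← Fintype.sum_prod_type', ← Equiv.sum_comp e1]
  refine Finset.sum_congr rfl fun i _ => ?_
  congr 3
  rw [← Fintype.sum_prod_type', ← Equiv.sum_comp e2, Finset.mul_sum]
  refine Finset.sum_congr rfl fun j _ => ?_
  rw [mul_assoc]
  congr 4
  simp [Pi.single_apply]
end

section
/- Consider the inverse problem for the 1D diffusion equation u_t(x,t) = f(x) u_{xx}(x,t) on [−1,1] × [t₀, t₁], with uniform spatial grid −1 = x_1 < x_2 < … < x_n = 1, x_{i+1} − x_i = h, and t₁ = t₀ + Δt. Write u_{0i} = u(x_i, t₀), u_{1i} = u(x_i, t₁), and observations U_{ki} = u_{ki} + W_{ki} (k = 0, 1). Assume: (i) |W_{ki}| ≤ ε_o for all i and k = 0, 1; (ii) f_θ ∈ C²([−1,1]) with |f_θ(x)| ≤ F₀ and |f_θ''(x)| ≤ F₂ for all x ∈ [−1,1]; (iii) the exact solution u ∈ C⁴([−1,1] × [t₀, t₁]), δ₂ = min_{(x,t)} |u_{xx}(x,t)| > 0 and u_{xx} does not change sign, δ₄ = max_{(x,t)} |u_{xxxx}(x,t)|, and f ∈ C²([−1,1]) with F₂^f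 = max_x |f''(x)|; (iv) the consistency bound: for each interior index i, | (u_{1i} − u_{0i})/Δt − f(x_i)(u_{1,i+1} + u_{1,i−1} − 2u_{1i})/(2h²) − f(x_i)(u_{0,i+1} + u_{0,i−1} − 2u_{0i})/(2h²) | ≤ C₁(Δt² + h²); (v) the optimization residual bound: for each interior index i, | (U_{1i} − U_{0i})/Δt − f_θ(x_i)(U_{1,i+1} + U_{1,i−1} − 2U_{1i})/(2h²) − f_θ(x_i)(U_{0,i+1} + U_{0,i−1} − 2U_{0i})/(2h²) | ≤ ε_opt; (vi) h < √(6δ₂/δ₄). Then for every x ∈ [−1+h, 1−h], |f_θ(x) − f(x)| ≤ (2C₁/δ₂) Δt² + (2C₁/δ₂ + (F₂ + F₂^f)/2) h² + (2/δ₂) ε_opt + (4/δ₂)(1/Δt + 2F₀/h²) ε_o. -/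
lemma aux_convex (φ : ℝ → ℝ) (m : ℝ) (hφ : ContDiffOn ℝ 2 φ (Set.Icc (-1 : ℝ) 1))
    (hm : ∀ X ∈ Set.Icc (-1 : ℝ) 1, m ≤ iteratedDerivWithin 2 φ (Set.Icc (-1 : ℝ) 1) X) :
    ConvexOn ℝ (Set.Icc (-1 : ℝ) 1) (fun y => φ y - m / 2 * y ^ 2) := by
  have key : ∀ y ∈ Set.Ioo (-1 : ℝ) 1,
      HasDerivAt φ (deriv φ y) y ∧ HasDerivAt (deriv φ) (deriv (deriv φ) y) y ∧
        m ≤ deriv (deriv φ) y := by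
    intro y hy
    have hnhds : Set.Icc (-1 : ℝ) 1 ∈ nhds y := Icc_mem_nhds hy.1 hy.2
    have hc : ContDiffAt ℝ 2 φ y := hφ.contDiffAt hnhds
    have h1 : DifferentiableAt ℝ φ y := hc.differentiableAt (by norm_num)
    have h2 : DifferentiableAt ℝ (deriv φ) y := by
      have := ContDiffAt.derivWithin (m := 1) hc (by norm_num)
      exact this.differentiableAt (by norm_num)
    refine ⟨h1.hasDerivAt, h2.hasDerivAt, ?_⟩
    have := hm y ⟨hy.1.le, hy.2.le⟩
    rw [iteratedDerivWithin_eq_iteratedDeriv (uniqueDiffOn_Icc (by norm_num)) hc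
      ⟨hy.1.le, hy.2.le⟩] at this
    simpa [iteratedDeriv_succ, iteratedDeriv_zero] using this
  refine convexOn_of_hasDerivWithinAt2_nonneg (f' := fun y => deriv φ y - m * y)
    (f'' := fun y => deriv (deriv φ) y - m) (convex_Icc _ _) ?_ ?_ ?_ ?_
  · exact hφ.continuousOn.sub (by fun_prop)
  · intro y hy
    rw [interior_Icc] at hy
    have := (key y hy).1.sub (((hasDerivAt_id y).pow 2).const_mul (m / 2))
    exact (this.congr_deriv (by simp; ring)).hasDerivWithinAt
  · intro y hy
    rw [interior_Icc] at hy
    have := (key y hy).2.1.sub ((hasDerivAt_id y).const_mul m)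
    exact (this.congr_deriv (by simp)).hasDerivWithinAt
  · intro y hy
    rw [interior_Icc] at hy
    linarith [(key y hy).2.2]

lemma aux_convex_neg (φ : ℝ → ℝ) (m : ℝ) (hφ : ContDiffOn ℝ 2 φ (Set.Icc (-1 : ℝ) 1))
    (hm : ∀ X ∈ Set.Icc (-1 : ℝ) 1, iteratedDerivWithin 2 φ (Set.Icc (-1 : ℝ) 1) X ≤ m) :
    ConvexOn ℝ (Set.Icc (-1 : ℝ) 1) (fun y => m / 2 * y ^ 2 - φ y) := by
  have := aux_convex (fun y => - φ y) (-m) hφ.neg (by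
    intro X hX
    have h := iteratedDerivWithin_fun_neg (n := 2) (s := Set.Icc (-1 : ℝ) 1) (x := X) (f := φ)
    rw [h]
    linarith [hm X hX])
  convert this using 2
  ring

lemma aux_diff (φ : ℝ → ℝ) (m a h : ℝ) (hh : 0 < h) (h1 : -1 ≤ a - h) (h2 : a + h ≤ 1)
    (hc : ConvexOn ℝ (Set.Icc (-1 : ℝ) 1) (fun y => φ y - m / 2 * y ^ 2)) :
    m * h ^ 2 ≤ φ (a + h) + φ (a - h) - 2 * φ a := by
  have hp : a + h ∈ Set.Icc (-1 : ℝ) 1 := ⟨by linarith, h2⟩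
  have hq : a - h ∈ Set.Icc (-1 : ℝ) 1 := ⟨h1, by linarith⟩
  have := hc.2 hp hq (by norm_num : (0 : ℝ) ≤ 1 / 2) (by norm_num : (0 : ℝ) ≤ 1 / 2) (by norm_num)
  simp only [smul_eq_mul] at this
  rw [show (1 / 2 : ℝ) * (a + h) + 1 / 2 * (a - h) = a by ring] at this
  nlinarith

lemma aux_interp (g : ℝ → ℝ) (M a h X E : ℝ) (hM : 0 ≤ M) (hh : 0 < h) (h1 : -1 ≤ a)
    (h2 : a + h ≤ 1) (hX1 : a ≤ X) (hX2 : X ≤ a + h) (hga : g a ≤ E) (hgb : g (a + h) ≤ E)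
    (hc : ConvexOn ℝ (Set.Icc (-1 : ℝ) 1) (fun y => g y + M / 2 * y ^ 2)) :
    g X ≤ E + M / 2 * h ^ 2 := by
  obtain ⟨s, hs⟩ : ∃ s, s = (X - a) / h := ⟨_, rfl⟩
  have hX : X = a + s * h := by rw [hs]; field_simp; ring
  have hs0 : 0 ≤ s := by rw [hs]; exact div_nonneg (by linarith) hh.le
  have hs1 : s ≤ 1 := by rw [hs, div_le_one hh]; linarith
  have hp : a ∈ Set.Icc (-1 : ℝ) 1 := ⟨h1, by linarith⟩
  have hq : a + h ∈ Set.Icc (-1 : ℝ) 1 := ⟨by linarith, h2⟩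
  have := hc.2 hp hq (by linarith : 0 ≤ 1 - s) hs0 (by ring)
  simp only [smul_eq_mul] at this
  rw [show (1 - s) * a + s * (a + h) = X by rw [hX]; ring] at this
  have e1 : (1 - s) * g a ≤ (1 - s) * E := mul_le_mul_of_nonneg_left hga (by linarith)
  have e2 : s * g (a + h) ≤ s * E := mul_le_mul_of_nonneg_left hgb hs0
  have e3 : (1 - s) * (M / 2 * a ^ 2) + s * (M / 2 * (a + h) ^ 2) - M / 2 * X ^ 2
      = M / 2 * h ^ 2 * (s * (1 - s)) := by rw [hX]; ring
  have e4 : M / 2 * h ^ 2 * (s * (1 - s)) ≤ M / 2 * h ^ 2 * 1 :=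
    mul_le_mul_of_nonneg_left (by nlinarith) (by positivity)
  linarith

/-- Error at a grid point. -/
lemma aux_alg (A0 A1 L0 R0 L1 R1 w0 w1 l0 r0 l1 r1 F G Δt h ε_o ε_opt δ₂ F₀ K : ℝ)
    (hΔt : 0 < Δt) (hh : 0 < h) (hδ₂ : 0 < δ₂)
    (hw0 : |w0| ≤ ε_o) (hw1 : |w1| ≤ ε_o) (hl0 : |l0| ≤ ε_o) (hl1 : |l1| ≤ ε_o)
    (hr0 : |r0| ≤ ε_o) (hr1 : |r1| ≤ ε_o) (hG : |G| ≤ F₀)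
    (hD : δ₂ ≤ |(R1 + L1 - 2 * A1) / (2 * h ^ 2) + (R0 + L0 - 2 * A0) / (2 * h ^ 2)|)
    (hcons : |(A1 - A0) / Δt - F * (R1 + L1 - 2 * A1) / (2 * h ^ 2)
      - F * (R0 + L0 - 2 * A0) / (2 * h ^ 2)| ≤ K)
    (hopt : |((A1 + w1) - (A0 + w0)) / Δt
      - G * ((R1 + r1) + (L1 + l1) - 2 * (A1 + w1)) / (2 * h ^ 2)
      - G * ((R0 + r0) + (L0 + l0) - 2 * (A0 + w0)) / (2 * h ^ 2)| ≤ ε_opt) :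
    |G - F| ≤ (K + ε_opt + 2 * (1 / Δt + 2 * F₀ / h ^ 2) * ε_o) / δ₂ := by
  rw [le_div_iff₀ hδ₂]
  obtain ⟨D, hDd⟩ : ∃ D, D = (R1 + L1 - 2 * A1) / (2 * h ^ 2) + (R0 + L0 - 2 * A0) / (2 * h ^ 2) :=
    ⟨_, rfl⟩
  rw [← hDd] at hD
  have n1 : |(w1 - w0) / Δt| ≤ 2 * (1 / Δt) * ε_o := by
    rw [abs_div, abs_of_pos hΔt, div_le_iff₀ hΔt]
    rw [show 2 * (1 / Δt) * ε_o * Δt = 2 * ε_o by field_simp]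
    rw [abs_le] at *
    constructor <;> linarith
  have n2 : |G * ((r1 + l1 - 2 * w1 + (r0 + l0 - 2 * w0)) / (2 * h ^ 2))|
      ≤ 2 * (2 * F₀ / h ^ 2) * ε_o := by
    have hb : |r1 + l1 - 2 * w1 + (r0 + l0 - 2 * w0)| ≤ 8 * ε_o := by
      clear hG hD hcons hopt n1
      rw [abs_le] at *
      constructor <;> linarith
    rw [abs_mul, abs_div, abs_of_pos (show (0 : ℝ) < 2 * h ^ 2 by positivity)]
    have hε : 0 ≤ ε_o := (abs_nonneg _).trans hw0
    calc _ ≤ F₀ * (8 * ε_o / (2 * h ^ 2)) := by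
          apply mul_le_mul hG _ (by positivity) ((abs_nonneg _).trans hG)
          gcongr
      _ = _ := by field_simp; ring
  have id : (G - F) * D = ((A1 - A0) / Δt - F * (R1 + L1 - 2 * A1) / (2 * h ^ 2)
      - F * (R0 + L0 - 2 * A0) / (2 * h ^ 2))
      - (((A1 + w1) - (A0 + w0)) / Δt
      - G * ((R1 + r1) + (L1 + l1) - 2 * (A1 + w1)) / (2 * h ^ 2)
      - G * ((R0 + r0) + (L0 + l0) - 2 * (A0 + w0)) / (2 * h ^ 2))
      + (w1 - w0) / Δt
      - G * ((r1 + l1 - 2 * w1 + (r0 + l0 - 2 * w0)) / (2 * h ^ 2)) := by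
    rw [hDd]; field_simp; ring
  have h3 : |(G - F) * D| ≤ K + ε_opt + 2 * (1 / Δt + 2 * F₀ / h ^ 2) * ε_o := by
    rw [id]
    clear id hD hG hw0 hw1 hl0 hl1 hr0 hr1
    rw [abs_le] at *
    constructor <;> linarith
  calc |G - F| * δ₂ ≤ |G - F| * |D| := by gcongr
    _ = |(G - F) * D| := (abs_mul _ _).symm
    _ ≤ _ := h3


/-- **Main error estimate** for the neural-network calibration of the
conductivity in the 1D diffusion problem `u_t = f(x) u_{xx}` on
`[−1,1] × [t₀, t₀+Δt]`.  On the uniform grid `x_i = −1 + i h` (0-indexed,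
`x_{n−1} = 1`), with noisy observations `U_{ki} = u(x_i, t_k) + W_{ki}`,
`|W_{ki}| ≤ ε_o`, calibrated `f_θ ∈ C²` with `|f_θ| ≤ F₀`, `|f_θ''| ≤ F₂`,
exact solution `u ∈ C⁴` with `min |u_{xx}| = δ₂ > 0` (and `u_{xx}` of constant
sign), `|u_{xxxx}| ≤ δ₄`, exact conductivity `f ∈ C²` with `|f''| ≤ F₂^f`,
Crank–Nicolson consistency error bounded by `C₁(Δt² + h²)`, optimization
residual bounded by `ε_opt`, and `h < √(6δ₂/δ₄)`, one has for every
`x ∈ [−1+h, 1−h]`: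
`|f_θ(x) − f(x)| ≤ (2C₁/δ₂)Δt² + (2C₁/δ₂ + (F₂+F₂^f)/2)h² + (2/δ₂)ε_opt
  + (4/δ₂)(1/Δt + 2F₀/h²)ε_o`. -/
theorem diffusion_inverse_main_error_estimate
    (t₀ Δt h ε_o ε_opt δ₂ δ₄ F₀ F₂ F₂f C₁ : ℝ)
    (hΔt : 0 < Δt) (hh : 0 < h)
    (n : ℕ) (hn : 3 ≤ n)
    (x : ℕ → ℝ) (hx : ∀ i, x i = -1 + i * h) (hgrid : x (n - 1) = 1)
    (u : ℝ → ℝ → ℝ) (f fθ : ℝ → ℝ)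
    (W₀ W₁ U₀ U₁ : ℕ → ℝ)
    -- (i) observation error
    (hW₀ : ∀ i < n, |W₀ i| ≤ ε_o) (hW₁ : ∀ i < n, |W₁ i| ≤ ε_o)
    (hU₀ : ∀ i < n, U₀ i = u (x i) t₀ + W₀ i)
    (hU₁ : ∀ i < n, U₁ i = u (x i) (t₀ + Δt) + W₁ i)
    -- (ii) the calibrated function is C² with bounded values and second derivative
    (hfθ : ContDiffOn ℝ 2 fθ (Set.Icc (-1 : ℝ) 1))
    (hF₀ : ∀ X ∈ Set.Icc (-1 : ℝ) 1, |fθ X| ≤ F₀)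
    (hF₂ : ∀ X ∈ Set.Icc (-1 : ℝ) 1,
      |iteratedDerivWithin 2 fθ (Set.Icc (-1 : ℝ) 1) X| ≤ F₂)
    -- (iii) regularity of the exact solution and of the exact conductivity
    (hu : ContDiffOn ℝ 4 (fun p : ℝ × ℝ => u p.1 p.2)
      (Set.Icc (-1 : ℝ) 1 ×ˢ Set.Icc t₀ (t₀ + Δt)))
    (hδ₂ : 0 < δ₂)
    (huxx_sign :
      (∀ t ∈ Set.Icc t₀ (t₀ + Δt), ∀ X ∈ Set.Icc (-1 : ℝ) 1,
        δ₂ ≤ iteratedDerivWithin 2 (fun y => u y t) (Set.Icc (-1 : ℝ) 1) X) ∨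
      (∀ t ∈ Set.Icc t₀ (t₀ + Δt), ∀ X ∈ Set.Icc (-1 : ℝ) 1,
        iteratedDerivWithin 2 (fun y => u y t) (Set.Icc (-1 : ℝ) 1) X ≤ -δ₂))
    (huxxxx : ∀ t ∈ Set.Icc t₀ (t₀ + Δt), ∀ X ∈ Set.Icc (-1 : ℝ) 1,
      |iteratedDerivWithin 4 (fun y => u y t) (Set.Icc (-1 : ℝ) 1) X| ≤ δ₄)
    (hf : ContDiffOn ℝ 2 f (Set.Icc (-1 : ℝ) 1))
    (hF₂f : ∀ X ∈ Set.Icc (-1 : ℝ) 1,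
      |iteratedDerivWithin 2 f (Set.Icc (-1 : ℝ) 1) X| ≤ F₂f)
    -- (iv) consistency bound of the Crank–Nicolson scheme on the exact solution
    (hC₁ : 0 < C₁)
    (hcons : ∀ i, 1 ≤ i → i ≤ n - 2 →
      |(u (x i) (t₀ + Δt) - u (x i) t₀) / Δt
        - f (x i) * (u (x (i + 1)) (t₀ + Δt) + u (x (i - 1)) (t₀ + Δt)
            - 2 * u (x i) (t₀ + Δt)) / (2 * h ^ 2)
        - f (x i) * (u (x (i + 1)) t₀ + u (x (i - 1)) t₀
            - 2 * u (x i) t₀) / (2 * h ^ 2)| ≤ C₁ * (Δt ^ 2 + h ^ 2))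
    -- (v) optimization residual bound
    (hopt : ∀ i, 1 ≤ i → i ≤ n - 2 →
      |(U₁ i - U₀ i) / Δt
        - fθ (x i) * (U₁ (i + 1) + U₁ (i - 1) - 2 * U₁ i) / (2 * h ^ 2)
        - fθ (x i) * (U₀ (i + 1) + U₀ (i - 1) - 2 * U₀ i) / (2 * h ^ 2)| ≤ ε_opt)
    -- (vi) grid size restriction
    (hsmall : h < Real.sqrt (6 * δ₂ / δ₄)) :
    ∀ X ∈ Set.Icc (-1 + h) (1 - h),
      |fθ X - f X|
        ≤ 2 * C₁ / δ₂ * Δt ^ 2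
          + (2 * C₁ / δ₂ + (F₂ + F₂f) / 2) * h ^ 2
          + 2 / δ₂ * ε_opt
          + 4 / δ₂ * (1 / Δt + 2 * F₀ / h ^ 2) * ε_o := by
  have hslice : ∀ t ∈ Set.Icc t₀ (t₀ + Δt),
      ContDiffOn ℝ 2 (fun y => u y t) (Set.Icc (-1 : ℝ) 1) := by
    intro t ht
    have h1 : ContDiffOn ℝ 4 (fun y : ℝ => ((y, t) : ℝ × ℝ)) (Set.Icc (-1 : ℝ) 1) := by fun_prop
    have h2 := hu.comp h1 (fun y hy => ⟨hy, ht⟩)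
    exact h2.of_le (by norm_num)
  have ht0 : t₀ ∈ Set.Icc t₀ (t₀ + Δt) := ⟨le_refl _, by linarith⟩
  have ht1 : t₀ + Δt ∈ Set.Icc t₀ (t₀ + Δt) := ⟨by linarith, le_refl _⟩
  have hlast : -1 + ((n : ℝ) - 1) * h = 1 := by
    rw [hx, Nat.cast_sub (by omega)] at hgrid
    simpa using hgrid
  have hxbound : ∀ i, 1 ≤ i → i ≤ n - 2 → -1 ≤ x i - h ∧ x i + h ≤ 1 := by
    intro i h1 h2
    have h1' : (1 : ℝ) ≤ i := by exact_mod_cast h1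
    have h2' : (i : ℝ) + 2 ≤ n := by exact_mod_cast (by omega : i + 2 ≤ n)
    rw [hx]
    constructor <;> nlinarith
  have hxs : ∀ i, x (i + 1) = x i + h := by
    intro i; rw [hx, hx]; push_cast; ring
  have hxp : ∀ i, 1 ≤ i → x (i - 1) = x i - h := by
    intro i hi; rw [hx, hx, Nat.cast_sub hi]; push_cast; ring
  -- lower bound of discrete second difference
  have hD : ∀ i, 1 ≤ i → i ≤ n - 2 →
      δ₂ ≤ |(u (x (i + 1)) (t₀ + Δt) + u (x (i - 1)) (t₀ + Δt)
            - 2 * u (x i) (t₀ + Δt)) / (2 * h ^ 2)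
          + (u (x (i + 1)) t₀ + u (x (i - 1)) t₀ - 2 * u (x i) t₀) / (2 * h ^ 2)| := by
    intro i h1 h2
    obtain ⟨hb1, hb2⟩ := hxbound i h1 h2
    rw [hxs, hxp i h1]
    rw [← add_div, abs_div, abs_of_pos (show (0 : ℝ) < 2 * h ^ 2 by positivity),
      le_div_iff₀ (by positivity)]
    rcases huxx_sign with hs | hs
    · have a0 := aux_diff _ _ (x i) h hh hb1 hb2 (aux_convex _ _ (hslice _ ht0) (hs _ ht0))
      have a1 := aux_diff _ _ (x i) h hh hb1 hb2 (aux_convex _ _ (hslice _ ht1) (hs _ ht1))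
      refine le_trans ?_ (le_abs_self _)
      linarith
    · have c0 := aux_convex_neg _ _ (hslice _ ht0) (hs _ ht0)
      have c1 := aux_convex_neg _ _ (hslice _ ht1) (hs _ ht1)
      have a0 := aux_diff (fun y => - u y t₀) δ₂ (x i) h hh hb1 hb2 (by convert c0 using 2; ring)
      have a1 := aux_diff (fun y => - u y (t₀ + Δt)) δ₂ (x i) h hh hb1 hb2
        (by convert c1 using 2; ring)
      refine le_trans ?_ (neg_le_abs _)
      linarith
  obtain ⟨E, hE⟩ : ∃ E, E = (C₁ * (Δt ^ 2 + h ^ 2) + ε_opt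
      + 2 * (1 / Δt + 2 * F₀ / h ^ 2) * ε_o) / δ₂ := ⟨_, rfl⟩
  have hgridE : ∀ i, 1 ≤ i → i ≤ n - 2 → |fθ (x i) - f (x i)| ≤ E := by
    intro i h1 h2
    obtain ⟨hb1, hb2⟩ := hxbound i h1 h2
    have ho := hopt i h1 h2
    rw [hU₀ i (by omega), hU₀ (i + 1) (by omega), hU₀ (i - 1) (by omega),
      hU₁ i (by omega), hU₁ (i + 1) (by omega), hU₁ (i - 1) (by omega)] at ho
    rw [hE]
    exact aux_alg _ _ _ _ _ _ _ _ _ _ _ _ _ _ Δt h ε_o ε_opt δ₂ F₀ _ hΔt hh hδ₂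
      (hW₀ i (by omega)) (hW₁ i (by omega)) (hW₀ (i - 1) (by omega)) (hW₁ (i - 1) (by omega))
      (hW₀ (i + 1) (by omega)) (hW₁ (i + 1) (by omega))
      (hF₀ _ ⟨by linarith, by linarith⟩) (hD i h1 h2) (hcons i h1 h2) ho
  have hE0 : 0 ≤ E := (abs_nonneg _).trans (hgridE 1 le_rfl (by omega))
  have hz : (0 : ℝ) ∈ Set.Icc (-1 : ℝ) 1 := by constructor <;> norm_num
  have hM : 0 ≤ F₂ + F₂f :=
    add_nonneg ((abs_nonneg _).trans (hF₂ 0 hz)) ((abs_nonneg _).trans (hF₂f 0 hz))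
  have hfin : 2 * C₁ / δ₂ * Δt ^ 2 + (2 * C₁ / δ₂ + (F₂ + F₂f) / 2) * h ^ 2
      + 2 / δ₂ * ε_opt + 4 / δ₂ * (1 / Δt + 2 * F₀ / h ^ 2) * ε_o
      = 2 * E + (F₂ + F₂f) / 2 * h ^ 2 := by
    rw [hE]; field_simp; ring
  intro X hX
  rw [hfin]
  suffices hs : |fθ X - f X| ≤ E + (F₂ + F₂f) / 2 * h ^ 2 by linarith
  have hcp : ConvexOn ℝ (Set.Icc (-1 : ℝ) 1)
      (fun y => (fθ y - f y) + (F₂ + F₂f) / 2 * y ^ 2) := by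
    have := (aux_convex fθ (-F₂) hfθ (fun y hy => (abs_le.1 (hF₂ y hy)).1)).add
      (aux_convex_neg f F₂f hf (fun y hy => (abs_le.1 (hF₂f y hy)).2))
    refine this.congr (fun y _ => ?_)
    simp only [Pi.add_apply]
    ring
  have hcn : ConvexOn ℝ (Set.Icc (-1 : ℝ) 1)
      (fun y => -(fθ y - f y) + (F₂ + F₂f) / 2 * y ^ 2) := by
    have := (aux_convex f (-F₂f) hf (fun y hy => (abs_le.1 (hF₂f y hy)).1)).add
      (aux_convex_neg fθ F₂ hfθ (fun y hy => (abs_le.1 (hF₂ y hy)).2))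
    refine this.congr (fun y _ => ?_)
    simp only [Pi.add_apply]
    ring
  obtain ⟨hX1, hX2⟩ := hX
  -- locate the cell
  obtain ⟨i, hi⟩ : ∃ i : ℕ, i = ⌊(X + 1) / h⌋₊ := ⟨_, rfl⟩
  have hpos : 0 ≤ (X + 1) / h := div_nonneg (by linarith) hh.le
  have hi1 : x i ≤ X := by
    have := Nat.floor_le hpos
    rw [← hi, le_div_iff₀ hh] at this
    rw [hx]; linarith
  have hi2 : X < x i + h := by
    have := Nat.lt_floor_add_one ((X + 1) / h)
    rw [← hi, div_lt_iff₀ hh] at this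
    rw [hx]; linarith
  have hi3 : 1 ≤ i := by
    rw [hi, Nat.one_le_floor_iff, le_div_iff₀ hh]; linarith
  have hi4 : i ≤ n - 2 := by
    have : (i : ℝ) * h ≤ ((n : ℝ) - 2) * h := by rw [hx] at hi1; linarith
    have := le_of_mul_le_mul_right this hh
    have : i + 2 ≤ n := by exact_mod_cast (by linarith : (i : ℝ) + 2 ≤ n)
    omega
  rcases Nat.lt_or_ge i (n - 2) with hlt | hge
  · obtain ⟨hb1, hb2⟩ := hxbound i hi3 hi4
    have g1 := abs_le.1 (hgridE i hi3 hi4)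
    have g2 := abs_le.1 (hgridE (i + 1) (by omega) (by omega))
    rw [hxs] at g2
    have p := aux_interp (fun y => fθ y - f y) _ (x i) h X E hM hh (by linarith) hb2 hi1 hi2.le
      g1.2 g2.2 hcp
    have q := aux_interp (fun y => -(fθ y - f y)) _ (x i) h X E hM hh (by linarith) hb2 hi1 hi2.le
      (by linarith [g1.1]) (by linarith [g2.1]) hcn
    rw [abs_le]
    constructor <;> linarith
  · have hin : i = n - 2 := by omega
    have hXi : X = x i := by
      refine le_antisymm ?_ hi1
      rw [hx, hin, Nat.cast_sub (by omega)]
      push_cast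
      linarith
    rw [hXi]
    have := hgridE i hi3 hi4
    have : 0 ≤ (F₂ + F₂f) / 2 * h ^ 2 := by positivity
    linarith
end
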